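/- arXiv:2405.19911 — 3 statements merged into one kernel-verified Lean document; each statement's English description precedes it below -/
import Mathlib

section
/- Let C = Orb(S) be a one-orbit cyclic subspace code in G_q(n,k) with k ≥ 1. Then C is a full weight spectrum code if and only if C = Orb(S) for a representative S of one of the following two forms: (1) S = ⟨1, λ, …, λ^{k−1}⟩_{F_q} for some λ ∈ F_{q^n} \ F_q, where k ≤ ([F_q(λ):F_q] + 1)/2 in case [F_q(λ):F_q] < n, and k ≤ n/2 in case [F_q(λ):F_q] = n; or (2) n is even, k = 2l+1 for some l ≥ 1, and S = ⟨1, λ, …, λ^{l−1}⟩_{F_{q^2}} ⊕ λ^l·F_q for some λ ∈ F_{q^n} \ F_{q^2} with l < [F_{q^2}(λ):F_{q^2}]/2. -/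
/-!
Setting: `q` is a prime power, realized by a finite field `Fq` with `Fintype.card Fq = q`;
`F` plays the role of `F_{q^n}`: a finite field extension of `Fq` with `Module.finrank Fq F = n`.
`F_q`-subspaces of `F_{q^n}` are `Submodule Fq F`; for a divisor `t` of `n`, the subfield
`F_{q^t}` is the (unique) `T : IntermediateField Fq F` with `Module.finrank Fq ↥T = t`, and
`F_{q^t}`-subspaces are `Submodule ↥T F`.
-/

set_option synthInstance.maxHeartbeats 1000000

namespace FWS

variable (R : Type*) {F : Type*} [Field R] [Field F] [Algebra R F]

/-- The cyclic shift `α S = {α * s : s ∈ S}` of an `R`-subspace `S` of `F`. -/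
def shift (α : F) (S : Submodule R F) : Submodule R F :=
  S.map (LinearMap.mulLeft R α)

/-- The subspace distance `d(U,V) = dim U + dim V - 2 dim (U ⊓ V)`
(which is `2k - 2 dim (U ⊓ V)` for `U, V` of the same dimension `k`). -/
noncomputable def sdist (U V : Submodule R F) : ℕ :=
  Module.finrank R ↥U + Module.finrank R ↥V - 2 * Module.finrank R ↥(U ⊓ V)

/-- The one-orbit cyclic subspace code `Orb(S) = {α S : α ∈ F*}`. -/
def orb (S : Submodule R F) : Set (Submodule R F) :=
  {T | ∃ α : F, α ≠ 0 ∧ T = shift R α S}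

/-- The weight `ω_{2i}(Orb(S)) = #{α S : α ∈ F*, d(S, α S) = 2 i}`. -/
noncomputable def omega (S : Submodule R F) (i : ℕ) : ℕ :=
  Nat.card {T : Submodule R F // T ∈ orb R S ∧ sdist R S T = 2 * i}

/-- `Orb(S)` is a full weight spectrum (FWS) code: `ω_{2i} > 0` for all `1 ≤ i ≤ dim S`. -/
def IsFWS (S : Submodule R F) : Prop :=
  ∀ i : ℕ, 1 ≤ i → i ≤ Module.finrank R ↥S → 0 < omega R S i

/-- The subspace `⟨1, l, ..., l^(k-1)⟩_R` spanned by the first `k` powers of `l`. -/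
def polySpan (l : F) (k : ℕ) : Submodule R F :=
  Submodule.span R ((fun i : ℕ => l ^ i) '' Set.Iio k)

/-- The invariant `m(Orb(S))`: the least divisor `t` of `n` such that
`dim_{F_{q^t}} ⟨S⟩_{F_{q^t}} = 1` (equivalently, the degree of the smallest subfield
containing a cyclic shift of `S`). -/
noncomputable def mOrb (S : Submodule R F) : ℕ :=
  sInf {t : ℕ | t ∣ Module.finrank R F ∧
    ∃ T : IntermediateField R F, Module.finrank R ↥T = t ∧
      Module.finrank ↥T ↥(Submodule.span ↥T (S : Set F)) = 1}

/-- The stabilizer `H(S) = {x ∈ F* : x S = S} ∪ {0}` of a set `S ⊆ F`, as a subset of `F`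
(it is a subfield of `F` when `S` is a subspace). -/
def stab {F : Type*} [Field F] (S : Set F) : Set F :=
  {x : F | x ≠ 0 ∧ (fun y => x * y) '' S = S} ∪ {0}

end FWS

open FWS

namespace FWS

section Shift

variable {R F : Type*} [Field R] [Field F] [Algebra R F]

lemma mem_shift {α : F} {S : Submodule R F} {x : F} :
    x ∈ shift R α S ↔ ∃ s ∈ S, α * s = x := by
  simp [shift]

lemma mul_mem_shift {α : F} {S : Submodule R F} {x : F} (hx : x ∈ S) : α * x ∈ shift R α S :=
  mem_shift.2 ⟨x, hx, rfl⟩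

lemma mul_mem_shift_iff {α : F} (hα : α ≠ 0) {S : Submodule R F} {x : F} :
    α * x ∈ shift R α S ↔ x ∈ S := by
  refine ⟨fun h => ?_, mul_mem_shift⟩
  obtain ⟨s, hs, h⟩ := mem_shift.1 h
  rwa [← mul_left_cancel₀ hα h]

lemma mulLeft_injective {α : F} (hα : α ≠ 0) :
    Function.Injective (LinearMap.mulLeft R α) := fun _ _ h => mul_left_cancel₀ hα h

lemma shift_mono {α : F} {S T : Submodule R F} (h : S ≤ T) : shift R α S ≤ shift R α T :=
  Submodule.map_mono h

lemma shift_shift (α β : F) (S : Submodule R F) :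
    shift R α (shift R β S) = shift R (α * β) S := by
  ext x
  simp [mem_shift, mul_assoc]

lemma shift_one (S : Submodule R F) : shift R 1 S = S := by
  ext x
  simp [mem_shift]

lemma shift_inv_shift {α : F} (hα : α ≠ 0) (S : Submodule R F) :
    shift R α⁻¹ (shift R α S) = S := by
  rw [shift_shift, inv_mul_cancel₀ hα, shift_one]

lemma shift_inf {α : F} (hα : α ≠ 0) (S T : Submodule R F) :
    shift R α (S ⊓ T) = shift R α S ⊓ shift R α T :=
  Submodule.map_inf _ (mulLeft_injective hα)

lemma shift_sup (α : F) (S T : Submodule R F) :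
    shift R α (S ⊔ T) = shift R α S ⊔ shift R α T :=
  Submodule.map_sup _ _ _

lemma finrank_shift {α : F} (hα : α ≠ 0) (S : Submodule R F) :
    Module.finrank R (shift R α S) = Module.finrank R S :=
  (Submodule.equivMapOfInjective _ (mulLeft_injective hα) S).finrank_eq.symm

lemma shift_span_singleton (α x : F) :
    shift R α (Submodule.span R {x}) = Submodule.span R {α * x} := by
  simp [shift, Submodule.map_span]

/-- The dimension of `S ⊓ α S`. -/
noncomputable def interDim (S : Submodule R F) (α : F) : ℕ :=
  Module.finrank R ↥(S ⊓ shift R α S)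

lemma interDim_mul_shift {β : F} (hβ : β ≠ 0) (S : Submodule R F) (α : F) :
    interDim (shift R β S) α = interDim S α := by
  rw [interDim, shift_shift, mul_comm α β, ← shift_shift, ← shift_inf hβ, finrank_shift hβ,
    interDim]

variable [FiniteDimensional R F]

lemma interDim_add_finrank_sup {α : F} (hα : α ≠ 0) (S : Submodule R F) :
    interDim S α + Module.finrank R ↥(S ⊔ shift R α S) = 2 * Module.finrank R S := by
  have := Submodule.finrank_sup_add_finrank_inf_eq S (shift R α S)
  rw [finrank_shift hα] at this
  rw [interDim]
  omega

lemma interDim_le (S : Submodule R F) (α : F) : interDim S α ≤ Module.finrank R S :=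
  Submodule.finrank_mono inf_le_left

/-- If `S` and `α S` both lie in `T`, they meet in codimension at most twice that of `S`. -/
lemma two_mul_finrank_le_of_le {α : F} (hα : α ≠ 0) {S T : Submodule R F} (hS : S ≤ T)
    (hαS : shift R α S ≤ T) : 2 * Module.finrank R S ≤ interDim S α + Module.finrank R T := by
  rw [← interDim_add_finrank_sup hα]
  exact Nat.add_le_add_left (Submodule.finrank_mono (sup_le hS hαS)) _

end Shift

section Stabilizer

variable {R F : Type*} [Field R] [Field F] [Algebra R F] [FiniteDimensional R F]

/-- The field of all `x` with `x V ⊆ V`. -/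
def stabField (V : Submodule R F) : IntermediateField R F :=
  Subalgebra.toIntermediateField
    { carrier := {x | ∀ v ∈ V, x * v ∈ V}
      mul_mem' := fun {a b} ha hb v hv => by rw [mul_assoc]; exact ha _ (hb v hv)
      add_mem' := fun {a b} ha hb v hv => by rw [add_mul]; exact V.add_mem (ha v hv) (hb v hv)
      algebraMap_mem' := fun r v hv => by
        rw [← Algebra.smul_def]; exact V.smul_mem r hv }
    (fun x hx => Subalgebra.inv_mem_of_algebraic (A := _) (x := ⟨x, hx⟩)
      (Algebra.IsAlgebraic.isAlgebraic x))

lemma mem_stabField {V : Submodule R F} {x : F} : x ∈ stabField V ↔ ∀ v ∈ V, x * v ∈ V := Iff.rfl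

lemma shift_eq_of_mem_stabField {V : Submodule R F} {α : F} (hα : α ≠ 0)
    (h : α ∈ stabField V) : shift R α V = V := by
  refine Submodule.eq_of_le_of_finrank_eq ?_ (finrank_shift hα V)
  intro x hx
  obtain ⟨v, hv, rfl⟩ := mem_shift.1 hx
  exact h v hv

lemma mem_stabField_of_shift_eq {V : Submodule R F} {α : F}
    (h : shift R α V = V) : α ∈ stabField V := fun _ hv => h ▸ mul_mem_shift hv

lemma le_stabField_inf {H : IntermediateField R F} {U V : Submodule R F} (hU : H ≤ stabField U)
    (hV : H ≤ stabField V) : H ≤ stabField (U ⊓ V) :=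
  fun _ hx v hv => ⟨hU hx v hv.1, hV hx v hv.2⟩

lemma le_stabField_sup {H : IntermediateField R F} {U V : Submodule R F} (hU : H ≤ stabField U)
    (hV : H ≤ stabField V) : H ≤ stabField (U ⊔ V) := by
  intro x hx v hv
  obtain ⟨u, hu, w, hw, rfl⟩ := Submodule.mem_sup.1 hv
  rw [mul_add]
  exact Submodule.add_mem_sup (hU hx u hu) (hV hx w hw)

lemma le_stabField_shift {H : IntermediateField R F} {V : Submodule R F} (hV : H ≤ stabField V)
    (α : F) : H ≤ stabField (shift R α V) := by
  intro x hx v hv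
  obtain ⟨u, hu, rfl⟩ := mem_shift.1 hv
  rw [mul_left_comm]
  exact mul_mem_shift (hV hx u hu)

lemma le_stabField_self (H : IntermediateField R F) :
    H ≤ stabField H.toSubalgebra.toSubmodule := fun _ hx _ hv => H.mul_mem hx hv

lemma finrank_sup_shift_field {H : IntermediateField R F} {U : Submodule R F}
    (hU : H ≤ stabField U) {v : F} (hv : v ∉ U) :
    Module.finrank R ↥(U ⊔ shift R v H.toSubalgebra.toSubmodule) =
      Module.finrank R U + Module.finrank R H := by
  have h0 : v ≠ 0 := by rintro rfl; exact hv U.zero_mem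
  have hd : U ⊓ shift R v H.toSubalgebra.toSubmodule = ⊥ := by
    rw [eq_bot_iff]
    rintro x ⟨hx, hx'⟩
    obtain ⟨y, hy, rfl⟩ := mem_shift.1 hx'
    have hy : y ∈ H := hy
    by_contra hne
    have hy0 : y ≠ 0 := by rintro rfl; simp at hne
    have := hU (H.inv_mem hy) _ hx
    rw [mul_comm v, inv_mul_cancel_left₀ hy0] at this
    exact hv this
  have := Submodule.finrank_sup_add_finrank_inf_eq U (shift R v H.toSubalgebra.toSubmodule)
  rw [hd, finrank_bot, finrank_shift h0] at this
  exact this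

/-- Nested distinct `H`-stable subspaces differ in dimension by at least `[H : R]`. -/
lemma finrank_add_finrank_le_of_stable {H : IntermediateField R F} {U V : Submodule R F}
    (hU : H ≤ stabField U) (hV : H ≤ stabField V) (hUV : U ≤ V) (hne : U ≠ V) :
    Module.finrank R U + Module.finrank R H ≤ Module.finrank R V := by
  obtain ⟨v, hv, hvU⟩ := SetLike.exists_of_lt (lt_of_le_of_ne hUV hne)
  rw [← finrank_sup_shift_field hU hvU]
  refine Submodule.finrank_mono (sup_le hUV ?_)
  intro x hx
  obtain ⟨y, hy, rfl⟩ := mem_shift.1 hx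
  rw [mul_comm]
  exact hV hy v hv

end Stabilizer

section Flag

variable {R F : Type*} [Field R] [Field F] [Algebra R F] [FiniteDimensional R F]

/-- Every dimension from `1` to `dim S` occurs as that of an intersection `S ⊓ α S`. -/
def AllInterDims (S : Submodule R F) : Prop :=
  ∀ r, 1 ≤ r → r ≤ Module.finrank R S → ∃ α : F, α ≠ 0 ∧ interDim S α = r

lemma finrank_inf_add_le_of_not_le {H : IntermediateField R F} {W S T E : Submodule R F}
    (hW : H ≤ stabField W) (hT : H ≤ stabField T) (hE : H ≤ stabField E)
    (hWS : W ≤ S)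
    (hTW : Module.finrank R T = Module.finrank R W + Module.finrank R H)
    (hET : E ≤ T) (hne : E ≠ T) (hEW : ¬ E ≤ W) :
    Module.finrank R ↥(S ⊓ E) + Module.finrank R H ≤ Module.finrank R S := by
  have h1 := finrank_add_finrank_le_of_stable hE hT hET hne
  have h2 := finrank_add_finrank_le_of_stable hW (le_stabField_sup hW hE) le_sup_left
    (fun h => hEW (h ▸ le_sup_right))
  have h3 : Module.finrank R ↥(W ⊔ E) ≤ Module.finrank R ↥(S ⊔ E) :=
    Submodule.finrank_mono (sup_le_sup_right hWS E)
  have h4 := Submodule.finrank_sup_add_finrank_inf_eq S E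
  omega

/-- Let `W ≤ S ≤ T` where `W` has stabilizer `H` and `T` is minimal among the `H`-stable
subspaces properly containing `W`. If `S` has all intersection dimensions, then `S ⊓ α S` is
either small or `α ∈ H`. -/
lemma interDim_add_le_or_mem_stabField {W S T : Submodule R F}
    (hW0 : W ≠ ⊥) (hT : stabField W ≤ stabField T) (hWS : W ≤ S) (hST : S ≤ T)
    (hTW : Module.finrank R T = Module.finrank R W + Module.finrank R (stabField W))
    (hlt : W ≠ S) (hS : AllInterDims S) {α : F} (hα : α ≠ 0) :
    interDim S α + Module.finrank R (stabField W) ≤ Module.finrank R S ∨ α ∈ stabField W := by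
  set H := stabField W with hH
  have hbot : Module.finrank R H ≤ Module.finrank R W := by
    have := finrank_add_finrank_le_of_stable (H := H) (U := ⊥) (V := W)
      (fun x _ v hv => by simp_all) le_rfl bot_le hW0.symm
    rwa [finrank_bot, zero_add] at this
  have hWltS : Module.finrank R W < Module.finrank R S :=
    Submodule.finrank_lt_finrank_of_lt (lt_of_le_of_ne hWS hlt)
  have hSleT : Module.finrank R S ≤ Module.finrank R T := Submodule.finrank_mono hST
  by_cases hαT : shift R α T = T
  · by_cases hαW : shift R α W = W
    · exact Or.inr (mem_stabField_of_shift_eq hαW)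
    exfalso
    set H' := stabField T with hH'
    have hHH' : Module.finrank R H + Module.finrank R H ≤ Module.finrank R H' := by
      refine finrank_add_finrank_le_of_stable (H := H) (U := H.toSubalgebra.toSubmodule)
        (V := H'.toSubalgebra.toSubmodule) (le_stabField_self H)
        (hT.trans (le_stabField_self H')) hT ?_
      intro h
      have : α ∈ H'.toSubalgebra.toSubmodule := mem_stabField_of_shift_eq hαT
      rw [← h] at this
      exact hαW (shift_eq_of_mem_stabField hα this)
    obtain ⟨β, hβ, hr⟩ := hS (2 * Module.finrank R S - Module.finrank R T - 1)
      (by omega) (by omega)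
    by_cases hβT : shift R β T = T
    · have := two_mul_finrank_le_of_le hβ hST ((shift_mono hST).trans hβT.le)
      omega
    · have h1 := finrank_add_finrank_le_of_stable (H := H') (U := T ⊓ shift R β T) (V := T)
        (le_stabField_inf le_rfl (le_stabField_shift le_rfl β)) le_rfl inf_le_left (by
          intro h
          refine hβT (Submodule.eq_of_le_of_finrank_eq (inf_eq_left.1 h) ?_).symm
          rw [finrank_shift hβ])
      have h2 : interDim S β ≤ Module.finrank R ↥(T ⊓ shift R β T) :=
        Submodule.finrank_mono (inf_le_inf hST (shift_mono hST))
      omega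
  · left
    have hne : T ⊓ shift R α T ≠ T := fun h => hαT
      (Submodule.eq_of_le_of_finrank_eq (inf_eq_left.1 h) (finrank_shift hα T).symm).symm
    have hne' : T ⊓ shift R α T ≠ shift R α T := fun h => hαT
      (Submodule.eq_of_le_of_finrank_eq (inf_eq_right.1 h) (finrank_shift hα T))
    have hE : H ≤ stabField (T ⊓ shift R α T) := le_stabField_inf hT (le_stabField_shift hT α)
    have hle : S ⊓ shift R α S ≤ T ⊓ shift R α T := inf_le_inf hST (shift_mono hST)
    by_cases hEW : T ⊓ shift R α T ≤ W
    · by_cases hEW' : T ⊓ shift R α T ≤ shift R α W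
      · have hEneW : T ⊓ shift R α T ≠ W := by
          intro h
          rw [h] at hEW'
          have hWα : shift R α W = W :=
            (Submodule.eq_of_le_of_finrank_eq hEW' (finrank_shift hα W).symm).symm
          exact hαT (shift_eq_of_mem_stabField hα (hT (mem_stabField_of_shift_eq hWα)))
        have h1 := finrank_add_finrank_le_of_stable hE le_rfl hEW hEneW
        have h2 : interDim S α ≤ _ := Submodule.finrank_mono hle
        omega
      · have h1 := finrank_inf_add_le_of_not_le (H := H) (le_stabField_shift le_rfl α)
          (le_stabField_shift hT α) hE (shift_mono hWS)
          (by rw [finrank_shift hα, finrank_shift hα, hTW]) inf_le_right hne' hEW'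
        have h2 : interDim S α ≤ _ := Submodule.finrank_mono (le_inf inf_le_right hle)
        rw [finrank_shift hα] at h1
        omega
    · have h1 := finrank_inf_add_le_of_not_le (H := H) le_rfl hT hE hWS hTW inf_le_left hne hEW
      have h2 : interDim S α ≤ _ := Submodule.finrank_mono (le_inf inf_le_left hle)
      omega

lemma finrank_stabField_eq_two {W S T : Submodule R F}
    (hW0 : W ≠ ⊥) (hT : stabField W ≤ stabField T) (hWS : W ≤ S) (hST : S ≤ T)
    (hTW : Module.finrank R T = Module.finrank R W + Module.finrank R (stabField W))
    (hWneS : W ≠ S) (hSneT : S ≠ T) (hS : AllInterDims S) :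
    Module.finrank R (stabField W) = 2 ∧ Module.finrank R S = Module.finrank R W + 1 := by
  have hbot : Module.finrank R (stabField W) ≤ Module.finrank R W := by
    have := finrank_add_finrank_le_of_stable (H := stabField W) (U := ⊥) (V := W)
      (fun x _ v hv => by simp_all) le_rfl bot_le hW0.symm
    rwa [finrank_bot, zero_add] at this
  have hWltS := Submodule.finrank_lt_finrank_of_lt (lt_of_le_of_ne hWS hWneS)
  have hSltT := Submodule.finrank_lt_finrank_of_lt (lt_of_le_of_ne hST hSneT)
  obtain ⟨α, hα, hr⟩ := hS (Module.finrank R S + 1 - Module.finrank R (stabField W))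
    (by omega) (by omega)
  rcases interDim_add_le_or_mem_stabField hW0 hT hWS hST hTW hWneS hS hα with h | h
  · omega
  have hWα := shift_eq_of_mem_stabField hα h
  have hTα := shift_eq_of_mem_stabField hα (hT h)
  have h1 : Module.finrank R W ≤ interDim S α :=
    Submodule.finrank_mono (le_inf hWS (hWα.ge.trans (shift_mono hWS)))
  have h2 := two_mul_finrank_le_of_le hα hST ((shift_mono hST).trans hTα.le)
  omega

end Flag

section PolySpan

variable {R F : Type*} [Field R] [Field F] [Algebra R F]

lemma pow_mem_polySpan (l : F) {i m : ℕ} (h : i < m) : l ^ i ∈ polySpan R l m :=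
  Submodule.subset_span ⟨i, h, rfl⟩

lemma polySpan_le_iff {l : F} {m : ℕ} {U : Submodule R F} :
    polySpan R l m ≤ U ↔ ∀ i < m, l ^ i ∈ U := by
  rw [polySpan, Submodule.span_le]
  exact ⟨fun h i hi => h ⟨i, hi, rfl⟩, by rintro h _ ⟨i, hi, rfl⟩; exact h i hi⟩

lemma shift_polySpan_le_iff {a l : F} {m : ℕ} {U : Submodule R F} :
    shift R a (polySpan R l m) ≤ U ↔ ∀ i < m, a * l ^ i ∈ U := by
  rw [shift, Submodule.map_le_iff_le_comap, polySpan_le_iff]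
  rfl

lemma polySpan_zero (l : F) : polySpan R l 0 = ⊥ := by
  simp [polySpan]

lemma polySpan_mono (l : F) {a b : ℕ} (h : a ≤ b) : polySpan R l a ≤ polySpan R l b :=
  polySpan_le_iff.2 fun _ hi => pow_mem_polySpan l (hi.trans_le h)

lemma polySpan_succ (l : F) (m : ℕ) :
    polySpan R l (m + 1) = polySpan R l m ⊔ Submodule.span R {l ^ m} := by
  refine le_antisymm (polySpan_le_iff.2 fun i hi => ?_)
    (sup_le (polySpan_mono l m.le_succ) ?_)
  · rcases Nat.lt_succ_iff_lt_or_eq.1 hi with h | rfl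
    · exact Submodule.mem_sup_left (pow_mem_polySpan l h)
    · exact Submodule.mem_sup_right (Submodule.mem_span_singleton_self _)
  · rw [Submodule.span_singleton_le_iff_mem]
    exact pow_mem_polySpan l m.lt_succ_self

lemma polySpan_sup_shift (l : F) {a b c : ℕ} (hab : b ≤ a) (hac : a ≤ b + c) :
    polySpan R l a ⊔ shift R (l ^ b) (polySpan R l c) = polySpan R l (b + c) := by
  refine le_antisymm (sup_le (polySpan_mono l hac) (shift_polySpan_le_iff.2 fun i hi => ?_))
    (polySpan_le_iff.2 fun i hi => ?_)
  · rw [← pow_add]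
    exact pow_mem_polySpan l (by omega)
  · by_cases h : i < a
    · exact Submodule.mem_sup_left (pow_mem_polySpan l h)
    · obtain ⟨e, rfl⟩ := Nat.exists_eq_add_of_le (hab.trans (not_lt.1 h))
      rw [pow_add]
      exact Submodule.mem_sup_right (mul_mem_shift (pow_mem_polySpan l (by omega)))

lemma polySpan_le_field {l : F} (m : ℕ) {H : IntermediateField R F} (h : l ∈ H) :
    polySpan R l m ≤ H.toSubalgebra.toSubmodule :=
  polySpan_le_iff.2 fun i _ => (pow_mem h i : l ^ i ∈ H)

lemma interDim_inv {α : F} (hα : α ≠ 0) (S : Submodule R F) :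
    interDim S α⁻¹ = interDim S α := by
  rw [interDim, interDim, ← finrank_shift hα, shift_inf hα, shift_shift, mul_inv_cancel₀ hα,
    shift_one, inf_comm]

variable [FiniteDimensional R F]

lemma finrank_polySpan {l : F} {m : ℕ}
    (h : m ≤ Module.finrank R (IntermediateField.adjoin R {l})) :
    Module.finrank R (polySpan R l m) = m := by
  rw [IntermediateField.adjoin.finrank (Algebra.IsIntegral.isIntegral l)] at h
  have hli := (linearIndependent_pow (K := R) l).comp (Fin.castLE h) (Fin.castLE_injective h)
  have := finrank_span_eq_card hli
  rw [Fintype.card_fin] at this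
  have hr : polySpan R l m = Submodule.span R (Set.range
      ((fun i : Fin (minpoly R l).natDegree => l ^ (i : ℕ)) ∘ Fin.castLE h)) := by
    rw [polySpan]
    congr 1
    ext x
    constructor
    · rintro ⟨i, hi, rfl⟩
      exact ⟨⟨i, hi⟩, rfl⟩
    · rintro ⟨i, rfl⟩
      exact ⟨i, i.2, rfl⟩
  rwa [hr]

lemma finrank_polySpan_le_finrank_adjoin (l : F) (m : ℕ) :
    Module.finrank R (polySpan R l m) ≤ Module.finrank R (IntermediateField.adjoin R {l}) :=
  Submodule.finrank_mono (polySpan_le_field m (IntermediateField.mem_adjoin_simple_self R l))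

lemma exists_sup_shift_polySpan {l : F} (hl : l ≠ 0) (S : Submodule R F)
    (h : Module.finrank R S ≤ interDim S l + 1) :
    ∃ (W : Submodule R F) (b : F) (j : ℕ), l ∈ stabField W ∧
      W ⊔ shift R b (polySpan R l j) = S ∧ Module.finrank R W + j = Module.finrank R S := by
  induction hd : Module.finrank R S using Nat.strong_induction_on generalizing S with
  | _ d ih =>
  by_cases hlS : l ∈ stabField S
  · exact ⟨S, 0, 0, hlS, by simp [polySpan_zero, shift], by simpa⟩
  have hmem : ∀ {U : Submodule R F} {x : F}, x ∈ shift R l⁻¹ U ↔ l * x ∈ U := by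
    intro U x
    rw [← mul_mem_shift_iff (R := R) hl, shift_shift, mul_inv_cancel₀ hl, shift_one]
  set S₁ := S ⊓ shift R l⁻¹ S with hS₁
  have hdim : Module.finrank R S₁ = interDim S l := interDim_inv hl S
  have hle : S₁ ≤ S := inf_le_left
  have hlS₁ : shift R l S₁ ≤ S := by
    intro x hx
    obtain ⟨y, hy, rfl⟩ := mem_shift.1 hx
    exact hmem.1 hy.2
  have hne : S₁ ≠ S := fun h' => hlS fun v hv => hmem.1 (h' ▸ hv : v ∈ S₁).2
  have hlt := Submodule.finrank_lt_finrank_of_lt (lt_of_le_of_ne hle hne)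
  by_cases hl₁ : l ∈ stabField S₁
  · obtain ⟨b, hb, hb'⟩ := SetLike.exists_of_lt (lt_of_le_of_ne hle hne)
    refine ⟨S₁, b, 1, hl₁, ?_, by omega⟩
    have hsup : S₁ ⊔ shift R b (polySpan R l 1) ≤ S :=
      sup_le hle (shift_polySpan_le_iff.2 fun i hi => by simpa [Nat.lt_one_iff.1 hi] using hb)
    have hlt' : S₁ < S₁ ⊔ shift R b (polySpan R l 1) := by
      refine lt_of_le_of_ne le_sup_left fun h' => hb' ?_
      rw [h']
      simpa using Submodule.mem_sup_right (S := S₁)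
        (mul_mem_shift (α := b) (pow_mem_polySpan (R := R) l Nat.zero_lt_one))
    have := Submodule.finrank_lt_finrank_of_lt hlt'
    exact Submodule.eq_of_le_of_finrank_le hsup (by omega)
  · have h2 := two_mul_finrank_le_of_le hl hle hlS₁
    obtain ⟨W, b, j, hW, hsup, hWj⟩ := ih _ (by omega) S₁ (by omega) rfl
    have hj : j ≠ 0 := by
      rintro rfl
      rw [polySpan_zero, shift, Submodule.map_bot, sup_bot_eq] at hsup
      exact hl₁ (hsup ▸ hW)
    have hbj : b * l ^ j ∉ S₁ := by
      intro hb
      refine hl₁ fun v hv => ?_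
      rw [← hsup] at hv
      obtain ⟨w, hw, y, hy, rfl⟩ := Submodule.mem_sup.1 hv
      rw [mul_add]
      refine S₁.add_mem (hsup ▸ Submodule.mem_sup_left (hW w hw)) ?_
      refine (shift_polySpan_le_iff (U := Submodule.comap (LinearMap.mulLeft R l) S₁)).2 ?_ hy
      intro i hi
      rw [Submodule.mem_comap, LinearMap.mulLeft_apply, mul_left_comm, ← pow_succ']
      rcases Nat.lt_or_eq_of_le (Nat.succ_le_of_lt hi) with h' | h'
      · exact hsup ▸ Submodule.mem_sup_right (mul_mem_shift (pow_mem_polySpan l h'))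
      · rwa [show i + 1 = j from h']
    have hbj' : b * l ^ j ∈ S := by
      obtain ⟨i, rfl⟩ := Nat.exists_eq_succ_of_ne_zero hj
      have : b * l ^ i ∈ S₁ :=
        hsup ▸ Submodule.mem_sup_right (mul_mem_shift (pow_mem_polySpan l i.lt_succ_self))
      rw [pow_succ', mul_left_comm]
      exact hmem.1 this.2
    refine ⟨W, b, j + 1, hW, ?_, by omega⟩
    rw [polySpan_succ, shift_sup, ← sup_assoc, hsup, shift_span_singleton]
    have hsup' : S₁ ⊔ Submodule.span R {b * l ^ j} ≤ S :=
      sup_le hle ((Submodule.span_singleton_le_iff_mem _ _).2 hbj')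
    have hlt' : S₁ < S₁ ⊔ Submodule.span R {b * l ^ j} := by
      refine lt_of_le_of_ne le_sup_left fun h' => hbj ?_
      rw [h']
      exact Submodule.mem_sup_right (Submodule.mem_span_singleton_self _)
    have := Submodule.finrank_lt_finrank_of_lt hlt'
    exact Submodule.eq_of_le_of_finrank_le hsup' (by omega)

lemma eq_shift_polySpan_or_exists_stabField {S : Submodule R F} (hS : AllInterDims S) {α : F}
    (hα : α ≠ 0) (h : interDim S α + 1 = Module.finrank R S) :
    (∃ b : F, b ≠ 0 ∧ S = shift R b (polySpan R α (Module.finrank R S))) ∨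
    ∃ W : Submodule R F, W ≠ ⊥ ∧ W ≤ S ∧ Module.finrank R (stabField W) = 2 ∧
      Module.finrank R S = Module.finrank R W + 1 ∧
      ∀ β : F, β ≠ 0 → interDim S β + 2 ≤ Module.finrank R S ∨ β ∈ stabField W := by
  obtain ⟨W, b, j, hαW, hsup, hWj⟩ := exists_sup_shift_polySpan hα S (by omega)
  have hαS : α ∉ stabField S := by
    intro hm
    rw [interDim, shift_eq_of_mem_stabField hα hm, inf_idem] at h
    omega
  by_cases hW0 : W = ⊥
  · left
    subst hW0
    rw [bot_sup_eq] at hsup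
    rw [finrank_bot, zero_add] at hWj
    refine ⟨b, ?_, by rw [← hWj, hsup]⟩
    rintro rfl
    have : S = ⊥ := by rw [← hsup]; simp [shift]
    subst this
    simp at h
  · right
    have hWS : W ≤ S := hsup ▸ le_sup_left
    have hWneS : W ≠ S := by rintro rfl; exact hαS hαW
    have hb : b ∉ W := by
      intro hb
      refine hWneS (le_antisymm hWS ?_)
      rw [← hsup]
      refine sup_le le_rfl (shift_polySpan_le_iff.2 fun i _ => ?_)
      rw [mul_comm]
      exact mem_stabField.1 (pow_mem hαW i) b hb
    have hT : stabField W ≤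
        stabField (W ⊔ shift R b (stabField W).toSubalgebra.toSubmodule) :=
      le_stabField_sup le_rfl (le_stabField_shift (le_stabField_self _) b)
    have hST : S ≤ W ⊔ shift R b (stabField W).toSubalgebra.toSubmodule := by
      rw [← hsup]
      exact sup_le_sup_left (shift_mono (polySpan_le_field j hαW)) W
    have hTW := finrank_sup_shift_field (H := stabField W) le_rfl hb
    have hSneT : S ≠ W ⊔ shift R b (stabField W).toSubalgebra.toSubmodule := by
      intro h'
      exact hαS (h' ▸ hT hαW)
    obtain ⟨h2, h1⟩ := finrank_stabField_eq_two hW0 hT hWS hST hTW hWneS hSneT hS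
    refine ⟨W, hW0, hWS, h2, h1, fun β hβ => ?_⟩
    rw [← h2]
    exact interDim_add_le_or_mem_stabField hW0 hT hWS hST hTW hWneS hS hβ

end PolySpan

section Spectrum

variable {R F : Type*} [Field R] [Field F] [Algebra R F]

lemma isFWS_iff [Finite F] {S : Submodule R F} :
    IsFWS R S ↔ ∀ r < Module.finrank R S, ∃ α : F, α ≠ 0 ∧ interDim S α = r := by
  have : Finite (Submodule R F) := Finite.of_injective _ SetLike.coe_injective
  have : Module.Finite R F := Module.Finite.of_finite
  have hd : ∀ α : F, α ≠ 0 → sdist R S (shift R α S) =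
      2 * Module.finrank R S - 2 * interDim S α := by
    intro α hα
    rw [sdist, finrank_shift hα, interDim, two_mul (Module.finrank R S)]
  have hpos : ∀ i, 0 < omega R S i ↔
      ∃ α : F, α ≠ 0 ∧ 2 * Module.finrank R S - 2 * interDim S α = 2 * i := by
    intro i
    rw [omega, Nat.card_pos_iff]
    constructor
    · rintro ⟨⟨_, ⟨α, hα, rfl⟩, h⟩, -⟩
      exact ⟨α, hα, by rw [← hd α hα, h]⟩
    · rintro ⟨α, hα, h⟩
      exact ⟨⟨_, ⟨α, hα, rfl⟩, by rw [hd α hα, h]⟩, inferInstance⟩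
  constructor
  · intro h r hr
    obtain ⟨α, hα, h⟩ := (hpos _).1 (h (Module.finrank R S - r) (by omega) (by omega))
    have := interDim_le S α
    exact ⟨α, hα, by omega⟩
  · intro h i hi hik
    obtain ⟨α, hα, h⟩ := h (Module.finrank R S - i) (by omega)
    exact (hpos i).2 ⟨α, hα, by omega⟩

lemma isFWS_shift_iff [Finite F] {S : Submodule R F} {β : F} (hβ : β ≠ 0) :
    IsFWS R (shift R β S) ↔ IsFWS R S := by
  simp only [isFWS_iff, finrank_shift hβ, interDim_mul_shift hβ]

lemma IsFWS.allInterDims [Finite F] {S : Submodule R F} (h : IsFWS R S) : AllInterDims S := by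
  intro r _ hr
  rcases hr.lt_or_eq with hr | rfl
  · exact isFWS_iff.1 h r hr
  · exact ⟨1, one_ne_zero, by rw [interDim, shift_one, inf_idem]⟩

lemma interDim_eq_zero_of_le_field {S : Submodule R F} {H : IntermediateField R F}
    (hS : S ≤ H.toSubalgebra.toSubmodule) {α : F} (hα : α ∉ H) : interDim S α = 0 := by
  have : S ⊓ shift R α S = ⊥ := by
    rw [eq_bot_iff]
    rintro x ⟨hx, hx'⟩
    obtain ⟨y, hy, rfl⟩ := mem_shift.1 hx'
    have hx : α * y ∈ H := hS hx
    have hy : y ∈ H := hS hy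
    by_contra hne
    have hy0 : y ≠ 0 := by rintro rfl; simp at hne
    exact hα (by simpa [hy0] using H.div_mem hx hy)
  rw [interDim, this, finrank_bot]

lemma two_mul_finrank_le_of_le_field [FiniteDimensional R F] {S : Submodule R F}
    {H : IntermediateField R F} (hS : S ≤ H.toSubalgebra.toSubmodule) {α : F} (hα : α ∈ H)
    (hα0 : α ≠ 0) : 2 * Module.finrank R S ≤ interDim S α + Module.finrank R H := by
  refine two_mul_finrank_le_of_le hα0 hS (?_ : _ ≤ H.toSubalgebra.toSubmodule)
  intro x hx
  obtain ⟨y, hy, rfl⟩ := mem_shift.1 hx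
  exact H.mul_mem hα (hS hy)

lemma exists_not_mem_of_finrank_lt [FiniteDimensional R F] {H : IntermediateField R F}
    (h : Module.finrank R H < Module.finrank R F) : ∃ α : F, α ∉ H := by
  by_contra! hall
  have : H = ⊤ := by ext x; simp [hall x]
  rw [this, IntermediateField.finrank_top'] at h
  exact h.false

lemma isFWS_polySpan [Finite F] {l : F} {k : ℕ} (hl : l ∉ Set.range (algebraMap R F))
    (h : (Module.finrank R (IntermediateField.adjoin R {l}) < Module.finrank R F ∧
        2 * k ≤ Module.finrank R (IntermediateField.adjoin R {l}) + 1) ∨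
      (Module.finrank R (IntermediateField.adjoin R {l}) = Module.finrank R F ∧
        2 * k ≤ Module.finrank R F)) : IsFWS R (polySpan R l k) := by
  have : Module.Finite R F := Module.Finite.of_finite
  have hl0 : l ≠ 0 := by
    rintro rfl
    exact hl ⟨0, map_zero _⟩
  have hpos : 0 < Module.finrank R (IntermediateField.adjoin R {l}) := Module.finrank_pos
  have hk := finrank_polySpan (R := R) (l := l) (m := k) (by omega)
  have key : ∀ i ≤ k, k + i ≤ Module.finrank R (IntermediateField.adjoin R {l}) →
      interDim (polySpan R l k) (l ^ i) = k - i := by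
    intro i hi hik
    have h1 := interDim_add_finrank_sup (pow_ne_zero i hl0) (polySpan R l k)
    rw [polySpan_sup_shift l hi (by omega), finrank_polySpan (by omega), hk] at h1
    omega
  rw [isFWS_iff, hk]
  intro r hr
  by_cases hr' : k + (k - r) ≤ Module.finrank R (IntermediateField.adjoin R {l})
  · exact ⟨l ^ (k - r), pow_ne_zero _ hl0, by rw [key _ (by omega) hr']; omega⟩
  · have h' : Module.finrank R (IntermediateField.adjoin R {l}) < Module.finrank R F ∧ r = 0 := by
      omega
    obtain ⟨α, hα⟩ := exists_not_mem_of_finrank_lt h'.1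
    refine ⟨α, ?_, ?_⟩
    · rintro rfl
      exact hα (zero_mem _)
    · rw [h'.2]
      exact interDim_eq_zero_of_le_field
        (polySpan_le_field k (IntermediateField.mem_adjoin_simple_self R l)) hα

end Spectrum

section Quadratic

variable {R F : Type*} [Field R] [Field F] [Algebra R F] {K : IntermediateField R F}

lemma finrank_restrictScalars (U : Submodule K F) :
    Module.finrank R (U.restrictScalars R) = Module.finrank R K * Module.finrank K U :=
  (Module.finrank_mul_finrank R K U).symm

lemma restrictScalars_sup (U V : Submodule K F) :
    (U ⊔ V).restrictScalars R = U.restrictScalars R ⊔ V.restrictScalars R := by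
  ext x
  simp [Submodule.mem_sup]

lemma restrictScalars_shift (α : F) (U : Submodule K F) :
    (shift K α U).restrictScalars R = shift R α (U.restrictScalars R) := by
  ext x
  simp [mem_shift]

lemma mul_mem_of_mem_field {c : F} (hc : c ∈ K) {U : Submodule K F} {x : F} (hx : x ∈ U) :
    c * x ∈ U := U.smul_mem (⟨c, hc⟩ : K) hx

lemma mem_of_mul_mem_of_mem_field {c : F} (hc : c ∈ K) (hc0 : c ≠ 0) {U : Submodule K F} {x : F}
    (hx : c * x ∈ U) : x ∈ U := by
  simpa [hc0] using mul_mem_of_mem_field (K.inv_mem hc) hx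

lemma exists_mem_notMem_range (hK : Module.finrank R K = 2) :
    ∃ c ∈ K, c ∉ Set.range (algebraMap R F) := by
  by_contra! h
  have : K = ⊥ := by
    rw [eq_bot_iff]
    intro x hx
    exact IntermediateField.mem_bot.2 (h x hx)
  rw [IntermediateField.finrank_eq_one_iff.2 this] at hK
  omega

lemma polySpan_sup_span_le (l : F) (m : ℕ) :
    (polySpan K l m).restrictScalars R ⊔ Submodule.span R {l ^ m} ≤
      (polySpan K l (m + 1)).restrictScalars R :=
  sup_le (polySpan_mono l m.le_succ)
    ((Submodule.span_singleton_le_iff_mem _ _).2 (pow_mem_polySpan l m.lt_succ_self))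

lemma restrictScalars_polySpan_sup_shift (l : F) {a b c : ℕ} (hab : b ≤ a) (hac : a ≤ b + c) :
    (polySpan K l a).restrictScalars R ⊔ shift R (l ^ b) ((polySpan K l c).restrictScalars R) =
      (polySpan K l (b + c)).restrictScalars R := by
  rw [← polySpan_sup_shift l hab hac, restrictScalars_sup, restrictScalars_shift]

variable [FiniteDimensional R F]

/-- A subspace between `polySpan K l m` and `polySpan K l (m + 1)` containing two multiples of
`l ^ m` that are independent over `R` is everything, when `K` is quadratic. -/
lemma finrank_eq_of_le_polySpan (hK : Module.finrank R K = 2) {l c : F} {m : ℕ}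
    (hm : m + 1 ≤ Module.finrank K (IntermediateField.adjoin K {l})) (hc : c ∈ K)
    (hcR : c ∉ Set.range (algebraMap R F)) {X : Submodule R F}
    (hX : X ≤ (polySpan K l (m + 1)).restrictScalars R)
    (hXm : (polySpan K l m).restrictScalars R ≤ X) (h1 : l ^ m ∈ X) (h2 : c * l ^ m ∈ X) :
    Module.finrank R X = 2 * (m + 1) := by
  have hlm : l ^ m ∉ polySpan K l m := by
    intro h
    have h' : polySpan K l (m + 1) = polySpan K l m := by
      rw [polySpan_succ, sup_eq_left, Submodule.span_singleton_le_iff_mem]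
      exact h
    have := finrank_polySpan hm
    rw [h', finrank_polySpan (by omega)] at this
    omega
  have hlm' : l ^ m ∉ (polySpan K l m).restrictScalars R := hlm
  have hclm : c * l ^ m ∉
      (polySpan K l m).restrictScalars R ⊔ Submodule.span R {l ^ m} := by
    intro h
    obtain ⟨p, hp, y, hy, h⟩ := Submodule.mem_sup.1 h
    obtain ⟨a, rfl⟩ := Submodule.mem_span_singleton.1 hy
    refine hlm (mem_of_mul_mem_of_mem_field (c := c - algebraMap R F a)
      (K.sub_mem hc (K.algebraMap_mem a)) (fun h0 => hcR ⟨a, (sub_eq_zero.1 h0).symm⟩) ?_)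
    have : (c - algebraMap R F a) * l ^ m = p := by
      rw [sub_mul, ← h, Algebra.smul_def, add_sub_cancel_right]
    rw [this]
    exact hp
  have e1 := Submodule.finrank_sup_span_singleton hlm'
  have e2 := Submodule.finrank_sup_span_singleton hclm
  have e3 := finrank_restrictScalars (R := R) (polySpan K l m)
  have e4 := finrank_restrictScalars (R := R) (polySpan K l (m + 1))
  rw [finrank_polySpan (by omega), hK] at e3
  rw [finrank_polySpan hm, hK] at e4
  have le1 := Submodule.finrank_mono hX
  have le2 := Submodule.finrank_mono
    (sup_le (sup_le hXm ((Submodule.span_singleton_le_iff_mem _ _).2 h1))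
      ((Submodule.span_singleton_le_iff_mem _ _).2 h2))
  omega

lemma finrank_polySpan_sup_span (hK : Module.finrank R K = 2) {l : F} {m : ℕ}
    (hm : m + 1 ≤ Module.finrank K (IntermediateField.adjoin K {l})) :
    Module.finrank R ↥((polySpan K l m).restrictScalars R ⊔ Submodule.span R {l ^ m}) =
      2 * m + 1 := by
  have hlm : l ^ m ∉ (polySpan K l m).restrictScalars R := by
    intro h
    have h' : polySpan K l (m + 1) = polySpan K l m := by
      rw [polySpan_succ, sup_eq_left, Submodule.span_singleton_le_iff_mem]
      exact h
    have := finrank_polySpan hm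
    rw [h', finrank_polySpan (by omega)] at this
    omega
  rw [Submodule.finrank_sup_span_singleton hlm, finrank_restrictScalars, hK,
    finrank_polySpan (by omega)]

lemma isFWS_polySpan_sup_span [Finite F] (hK : Module.finrank R K = 2) {l : F} (hl : l ∉ K)
    {m : ℕ} (hm : 2 * m < Module.finrank K (IntermediateField.adjoin K {l})) :
    IsFWS R ((polySpan K l m).restrictScalars R ⊔ Submodule.span R {l ^ m}) := by
  have hl0 : l ≠ 0 := by
    rintro rfl
    exact hl (zero_mem _)
  obtain ⟨c, hc, hcR⟩ := exists_mem_notMem_range hK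
  have hk := finrank_polySpan_sup_span (R := R) hK (l := l) (m := m) (by omega)
  set S := (polySpan K l m).restrictScalars R ⊔ Submodule.span R {l ^ m} with hS
  have odd : ∀ i, 1 ≤ i → i ≤ m → interDim S (l ^ i) = 2 * (m - i) + 1 := by
    intro i hi him
    have hsup : S ⊔ shift R (l ^ i) S =
        (polySpan K l (i + m)).restrictScalars R ⊔ Submodule.span R {l ^ (i + m)} := by
      rw [hS, shift_sup, shift_span_singleton, ← pow_add, sup_sup_sup_comm,
        restrictScalars_polySpan_sup_shift l him (by omega), ← sup_assoc]
      congr 1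
      rw [sup_eq_left, Submodule.span_singleton_le_iff_mem]
      exact pow_mem_polySpan l (by omega)
    have := interDim_add_finrank_sup (pow_ne_zero i hl0) S
    rw [hsup, hk, finrank_polySpan_sup_span hK (by omega)] at this
    omega
  have even : ∀ d ≤ m, ∃ α : F, α ≠ 0 ∧ interDim S α = 2 * (m - d) := by
    intro d hd
    have hld : l ^ d ≠ 0 := pow_ne_zero d hl0
    have hα : (c + (l ^ d)⁻¹) * l ^ d = c * l ^ d + 1 := by
      rw [add_mul, inv_mul_cancel₀ hld]
    have hX : Module.finrank R ↥(shift R (l ^ d) S ⊔ shift R (c * l ^ d + 1) S) =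
        2 * (d + m + 1) := by
      have mem1 : ∀ {x : F}, x ∈ S → l ^ d * x ∈
          shift R (l ^ d) S ⊔ shift R (c * l ^ d + 1) S := fun hx =>
        Submodule.mem_sup_left (mul_mem_shift hx)
      have mem2 : ∀ {x : F}, x ∈ S → (c * l ^ d + 1) * x ∈
          shift R (l ^ d) S ⊔ shift R (c * l ^ d + 1) S := fun hx =>
        Submodule.mem_sup_right (mul_mem_shift hx)
      have hPS : (polySpan K l m).restrictScalars R ≤ S := le_sup_left
      have hlS : l ^ m ∈ S := Submodule.mem_sup_right (Submodule.mem_span_singleton_self _)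
      have hP : (polySpan K l (d + m)).restrictScalars R ≤
          shift R (l ^ d) S ⊔ shift R (c * l ^ d + 1) S := by
        rw [← restrictScalars_polySpan_sup_shift l hd (by omega)]
        refine sup_le (fun x hx => ?_) ((shift_mono hPS).trans le_sup_left)
        have e : x = (c * l ^ d + 1) * x - l ^ d * (c * x) := by ring
        rw [e]
        exact Submodule.sub_mem _ (mem2 (hPS hx)) (mem1 (hPS (mul_mem_of_mem_field hc hx)))
      have hl1 : l ^ (d + m) ∈ shift R (l ^ d) S ⊔ shift R (c * l ^ d + 1) S := by
        rw [pow_add]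
        exact mem1 hlS
      refine finrank_eq_of_le_polySpan hK (by omega) hc hcR (sup_le ?_ ?_) hP hl1 ?_
      · intro x hx
        obtain ⟨y, hy, rfl⟩ := mem_shift.1 hx
        have hy' := polySpan_sup_span_le l m hy
        rw [add_assoc, ← restrictScalars_polySpan_sup_shift (a := m + 1) l (by omega) (by omega)]
        exact Submodule.mem_sup_right (mul_mem_shift hy')
      · intro x hx
        obtain ⟨y, hy, rfl⟩ := mem_shift.1 hx
        have hy' := polySpan_sup_span_le l m hy
        rw [add_assoc, ← restrictScalars_polySpan_sup_shift (a := m + 1) l (by omega) (by omega),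
          add_mul, one_mul, mul_assoc, mul_left_comm]
        exact Submodule.add_mem _
          (Submodule.mem_sup_right (mul_mem_shift (mul_mem_of_mem_field hc hy')))
          (Submodule.mem_sup_left hy')
      · have e : c * l ^ (d + m) = (c * l ^ d + 1) * l ^ m - l ^ m := by ring
        rw [e]
        refine Submodule.sub_mem _ (mem2 hlS) ?_
        rcases Nat.eq_zero_or_pos d with rfl | hd0
        · simpa using hl1
        · exact hP (pow_mem_polySpan l (by omega))
    have hα0 : c + (l ^ d)⁻¹ ≠ 0 := by
      intro h0
      rw [← hα, h0, zero_mul] at hX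
      have : shift R (0 : F) S = ⊥ := by simp [shift]
      rw [this, sup_bot_eq, finrank_shift hld, hk] at hX
      omega
    refine ⟨_, hα0, ?_⟩
    have := interDim_add_finrank_sup hα0 (shift R (l ^ d) S)
    rw [shift_shift, hα, hX, interDim_mul_shift hld, finrank_shift hld, hk] at this
    omega
  rw [isFWS_iff, hk]
  intro r hr
  rcases Nat.even_or_odd' r with ⟨s, rfl | rfl⟩
  · obtain ⟨α, hα, h⟩ := even (m - s) (by omega)
    exact ⟨α, hα, by omega⟩
  · exact ⟨l ^ (m - s), pow_ne_zero _ hl0, by rw [odd _ (by omega) (by omega)]; omega⟩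

end Quadratic

section PolySpanTransform

variable {R F : Type*} [Field R] [Field F] [Algebra R F]

lemma mul_mem_polySpan_succ {l x : F} {m : ℕ} (hx : x ∈ polySpan R l m) :
    l * x ∈ polySpan R l (m + 1) := by
  have h : shift R l (polySpan R l m) ≤ polySpan R l (m + 1) :=
    shift_polySpan_le_iff.2 fun i hi => by
      rw [← pow_succ']
      exact pow_mem_polySpan l (by omega)
  exact h (mul_mem_shift hx)

lemma polySpan_sub_algebraMap_le (l : F) (c : R) (m : ℕ) :
    polySpan R (l - algebraMap R F c) m ≤ polySpan R l m := by
  have h : ∀ i, (l - algebraMap R F c) ^ i ∈ polySpan R l (i + 1) := by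
    intro i
    induction i with
    | zero => simpa using pow_mem_polySpan (R := R) l Nat.zero_lt_one
    | succ i ih =>
      rw [pow_succ', sub_mul, ← Algebra.smul_def]
      exact Submodule.sub_mem _ (mul_mem_polySpan_succ ih)
        (Submodule.smul_mem _ _ (polySpan_mono l (Nat.le_succ _) ih))
  exact polySpan_le_iff.2 fun i hi => polySpan_mono l hi (h i)

lemma polySpan_sub_algebraMap (l : F) (c : R) (m : ℕ) :
    polySpan R (l - algebraMap R F c) m = polySpan R l m := by
  refine le_antisymm (polySpan_sub_algebraMap_le l c m) ?_
  simpa using polySpan_sub_algebraMap_le (l - algebraMap R F c) (-c) m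

lemma shift_pow_polySpan_inv {l : F} (hl : l ≠ 0) (m : ℕ) :
    shift R (l ^ m) (polySpan R l⁻¹ (m + 1)) = polySpan R l (m + 1) := by
  have key : ∀ i < m + 1, l ^ m * l⁻¹ ^ i = l ^ (m - i) := by
    intro i hi
    rw [inv_pow, pow_sub₀ l hl (by omega)]
  refine le_antisymm (shift_polySpan_le_iff.2 fun i hi => ?_) (polySpan_le_iff.2 fun i hi => ?_)
  · rw [key i hi]
    exact pow_mem_polySpan l (by omega)
  · rw [show i = m - (m - i) by omega, ← key (m - i) (by omega)]
    exact mul_mem_shift (pow_mem_polySpan _ (by omega))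

end PolySpanTransform

section Quadratic

variable {R F : Type*} [Field R] [Field F] [Algebra R F] {K : IntermediateField R F}

lemma interDim_restrictScalars (U : Submodule K F) (α : F) :
    interDim (U.restrictScalars R) α = Module.finrank R K * interDim U α := by
  rw [interDim, interDim, ← restrictScalars_shift, ← finrank_restrictScalars]
  rfl

lemma restrictScalars_sup_span_le (W : Submodule K F) (e : F) :
    W.restrictScalars R ⊔ Submodule.span R {e} ≤
      (W ⊔ Submodule.span K {e}).restrictScalars R := by
  refine sup_le (fun x hx => Submodule.mem_sup_left (S := W) hx) ?_
  rw [Submodule.span_singleton_le_iff_mem]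
  exact Submodule.mem_sup_right (S := W) (Submodule.mem_span_singleton_self _)

lemma mem_of_mem_of_mul_mem {W : Submodule K F} {e : F} (he : e ∉ W) {ζ : F} (hζ : ζ ∈ K)
    (hζR : ζ ∉ Set.range (algebraMap R F)) {x : F}
    (hx : x ∈ W.restrictScalars R ⊔ Submodule.span R {e})
    (hζx : ζ * x ∈ W.restrictScalars R ⊔ Submodule.span R {e}) : x ∈ W := by
  obtain ⟨u, hu, y, hy, rfl⟩ := Submodule.mem_sup.1 hx
  obtain ⟨a, rfl⟩ := Submodule.mem_span_singleton.1 hy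
  obtain ⟨v, hv, z, hz, h⟩ := Submodule.mem_sup.1 hζx
  obtain ⟨a', rfl⟩ := Submodule.mem_span_singleton.1 hz
  have hu : u ∈ W := hu
  have hv : v ∈ W := hv
  rw [Algebra.smul_def] at h ⊢
  rw [Algebra.smul_def] at h
  by_cases hd : ζ * algebraMap R F a - algebraMap R F a' = 0
  · have ha : a = 0 := by
      by_contra ha
      have ha' : algebraMap R F a ≠ 0 := by simpa using ha
      exact hζR ⟨a' / a, by rw [map_div₀, div_eq_iff ha', sub_eq_zero.1 hd]⟩
    simpa [ha] using hu
  · refine absurd (mem_of_mul_mem_of_mem_field (c := ζ * algebraMap R F a - algebraMap R F a')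
      (K.sub_mem (K.mul_mem hζ (K.algebraMap_mem a)) (K.algebraMap_mem a')) hd (U := W) ?_) he
    have e1 : (ζ * algebraMap R F a - algebraMap R F a') * e = v - ζ * u := by
      linear_combination -h
    rw [e1]
    exact W.sub_mem hv (mul_mem_of_mem_field hζ hu)

variable [FiniteDimensional R F]

/-- A subspace stable under `K`, as a `K`-subspace. -/
def extendScalars (W : Submodule R F) (h : K ≤ stabField W) : Submodule K F :=
  { W with smul_mem' := fun c x hx => h c.2 x hx }

lemma interDim_le_add_two {S T : Submodule R F} (hST : S ≤ T)
    (hT : Module.finrank R T = Module.finrank R S + 1) {α : F} (hα : α ≠ 0) :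
    interDim T α ≤ interDim S α + 2 := by
  have h1 := Submodule.finrank_sup_add_finrank_inf_eq S (T ⊓ shift R α T)
  have h2 := Submodule.finrank_sup_add_finrank_inf_eq (shift R α S) (T ⊓ shift R α T)
  have h3 := Submodule.finrank_sup_add_finrank_inf_eq (S ⊓ (T ⊓ shift R α T))
    (shift R α S ⊓ (T ⊓ shift R α T))
  have le1 : Module.finrank R ↥(S ⊔ T ⊓ shift R α T) ≤ Module.finrank R T :=
    Submodule.finrank_mono (sup_le hST inf_le_left)
  have le2 : Module.finrank R ↥(shift R α S ⊔ T ⊓ shift R α T) ≤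
      Module.finrank R (shift R α T) :=
    Submodule.finrank_mono (sup_le (shift_mono hST) inf_le_right)
  have le3 : _ ≤ Module.finrank R ↥(T ⊓ shift R α T) :=
    Submodule.finrank_mono (sup_le (inf_le_right (a := S)) (inf_le_right (a := shift R α S)))
  have le4 : _ ≤ interDim S α := Submodule.finrank_mono
    (inf_le_inf (inf_le_left (b := T ⊓ shift R α T)) (inf_le_left (b := T ⊓ shift R α T)))
  rw [finrank_shift hα] at h2 le2
  have e : interDim T α = Module.finrank R ↥(T ⊓ shift R α T) := rfl
  omega

lemma finrank_restrictScalars_sup_span (hK : Module.finrank R K = 2) {W : Submodule K F} {e : F}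
    (he : e ∉ W) : Module.finrank R ↥(W.restrictScalars R ⊔ Submodule.span R {e}) =
      2 * Module.finrank K W + 1 := by
  have he' : e ∉ W.restrictScalars R := he
  rw [Submodule.finrank_sup_span_singleton he', finrank_restrictScalars, hK]

lemma interDim_sup_span_bounds (hK : Module.finrank R K = 2) {W : Submodule K F} {e : F}
    (he : e ∉ W) {α : F} (hα : α ≠ 0) :
    interDim (W.restrictScalars R ⊔ Submodule.span R {e}) α ≤
      2 * interDim (W ⊔ Submodule.span K {e}) α ∧
    2 * interDim (W ⊔ Submodule.span K {e}) α ≤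
      interDim (W.restrictScalars R ⊔ Submodule.span R {e}) α + 2 := by
  have hle := restrictScalars_sup_span_le (R := R) W e
  have h := interDim_restrictScalars (R := R) (W ⊔ Submodule.span K {e}) α
  rw [hK] at h
  rw [← h]
  refine ⟨Submodule.finrank_mono (inf_le_inf hle (shift_mono hle)), interDim_le_add_two hle ?_ hα⟩
  rw [finrank_restrictScalars, hK, Submodule.finrank_sup_span_singleton he,
    finrank_restrictScalars_sup_span hK he]
  ring

lemma allInterDims_sup_span (hK : Module.finrank R K = 2) {W : Submodule K F} {e : F}
    (he : e ∉ W) (h : AllInterDims (W.restrictScalars R ⊔ Submodule.span R {e})) :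
    AllInterDims (W ⊔ Submodule.span K {e}) := by
  intro x hx hxw
  rw [Submodule.finrank_sup_span_singleton he] at hxw
  obtain ⟨α, hα, hr⟩ := h (2 * x - 1) (by omega)
    (by rw [finrank_restrictScalars_sup_span hK he]; omega)
  have := interDim_sup_span_bounds hK he hα
  exact ⟨α, hα, by omega⟩

lemma not_forall_interDim_or_mem_stabField (hK : Module.finrank R K = 2) {W W' : Submodule K F}
    {e : F} (he : e ∉ W) (hW : W ≠ ⊥)
    (hS : AllInterDims (W.restrictScalars R ⊔ Submodule.span R {e}))
    (hle : W' ≤ W ⊔ Submodule.span K {e})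
    (hfr : Module.finrank K ↥(W ⊔ Submodule.span K {e}) = Module.finrank K W' + 1)
    (hst : ∀ β : F, β ≠ 0 → interDim (W ⊔ Submodule.span K {e}) β + 2 ≤
      Module.finrank K ↥(W ⊔ Submodule.span K {e}) ∨ β ∈ stabField W') : False := by
  have hTW := Submodule.finrank_sup_span_singleton he
  have hSdim := finrank_restrictScalars_sup_span (R := R) hK he
  have hw : 1 ≤ Module.finrank K W := Submodule.one_le_finrank_iff.2 hW
  obtain ⟨α, hα, hr⟩ := hS (2 * Module.finrank K W - 1) (by omega) (by omega)
  have hb := interDim_sup_span_bounds (R := R) hK he hα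
  set S := W.restrictScalars R ⊔ Submodule.span R {e} with hSdef
  set T := W ⊔ Submodule.span K {e} with hTdef
  have hαst : α ∈ stabField W' := (hst α hα).resolve_left (by omega)
  have hαW' := shift_eq_of_mem_stabField hα hαst
  have hαK : α ∉ K := by
    intro hmem
    have : shift K α T = T :=
      shift_eq_of_mem_stabField hα fun v hv => mul_mem_of_mem_field hmem hv
    have : interDim T α = Module.finrank K T := by rw [interDim, this, inf_idem]
    omega
  have hE : W' = T ⊓ shift K α T := by
    refine Submodule.eq_of_le_of_finrank_eq (le_inf hle (hαW'.ge.trans (shift_mono hle))) ?_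
    change _ = interDim T α
    omega
  have hαW'r : shift R α (W'.restrictScalars R) = W'.restrictScalars R := by
    rw [← restrictScalars_shift, hαW']
  have hVW' : S ⊓ shift R α S ≤ W'.restrictScalars R := by
    rw [hE]
    change _ ≤ T.restrictScalars R ⊓ (shift K α T).restrictScalars R
    rw [restrictScalars_shift]
    exact inf_le_inf (restrictScalars_sup_span_le W e)
      (shift_mono (restrictScalars_sup_span_le W e))
  have hW'dim : Module.finrank R (W'.restrictScalars R) = 2 * Module.finrank K W := by
    rw [finrank_restrictScalars, hK]
    omega
  have hVdim : Module.finrank R ↥(S ⊓ shift R α S) = 2 * Module.finrank K W - 1 := hr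
  have hW'S : ¬ W'.restrictScalars R ≤ S := by
    intro h
    have := Submodule.finrank_mono (le_inf h (hαW'r.ge.trans (shift_mono h)))
    omega
  have hV : S ⊓ shift R α S = S ⊓ W'.restrictScalars R := by
    refine Submodule.eq_of_le_of_finrank_le (le_inf inf_le_left hVW') ?_
    have := Submodule.finrank_lt_finrank_of_lt (inf_lt_right.2 hW'S)
    omega
  have hαV : S ⊓ shift R α S = shift R α (S ⊓ shift R α S) := by
    refine Submodule.eq_of_le_of_finrank_eq ?_ (finrank_shift hα _).symm
    conv_rhs => rw [hV, shift_inf hα, hαW'r]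
    exact le_inf inf_le_right hVW'
  have hgap := finrank_add_finrank_le_of_stable (H := IntermediateField.adjoin R {α})
    (IntermediateField.adjoin_simple_le_iff.2 (mem_stabField_of_shift_eq hαV.symm))
    (IntermediateField.adjoin_simple_le_iff.2 (mem_stabField_of_shift_eq hαW'r)) hVW'
    (fun h => by rw [h] at hVdim; omega)
  have hpos : 0 < Module.finrank R (IntermediateField.adjoin R {α}) := Module.finrank_pos
  have h1 : Module.finrank R (IntermediateField.adjoin R {α}) = 1 := by omega
  rw [IntermediateField.finrank_adjoin_simple_eq_one_iff] at h1
  exact hαK ((bot_le : ⊥ ≤ K) h1)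

/-- If `α P` is a hyperplane of `T = W + K e` and `S = W + R e` meets `α S` in codimension two,
then `W` is `P`, or an affine translate of `α` maps `P` onto `W`. -/
lemma eq_or_exists_shift_sub_eq (hK : Module.finrank R K = 2) {W P : Submodule K F} {e α : F}
    (he : e ∉ W) (hα : α ≠ 0) (hαK : α ∉ K) (hPT : P ≤ W ⊔ Submodule.span K {e})
    (hPdim : Module.finrank K P = Module.finrank K W)
    (hE : (W ⊔ Submodule.span K {e}) ⊓ shift K α (W ⊔ Submodule.span K {e}) = shift K α P)
    (hr : interDim (W.restrictScalars R ⊔ Submodule.span R {e}) α + 1 =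
      2 * Module.finrank K W) :
    W = P ∨ ∃ c : K, W = shift K (α - algebraMap K F c) P := by
  by_cases hWP : W = P
  · exact Or.inl hWP
  right
  have hTW := Submodule.finrank_sup_span_singleton he
  have hSdim := finrank_restrictScalars_sup_span (R := R) hK he
  set S := W.restrictScalars R ⊔ Submodule.span R {e} with hSdef
  set T := W ⊔ Submodule.span K {e} with hTdef
  have hαPT : shift K α P ≤ T := hE ▸ inf_le_left
  have hαPdim := finrank_shift (R := K) hα P
  suffices h : ∃ c : K, shift K (α - algebraMap K F c) P ≤ W by
    obtain ⟨c, hc⟩ := h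
    refine ⟨c, (Submodule.eq_of_le_of_finrank_eq hc ?_).symm⟩
    rw [finrank_shift, hPdim]
    intro h0
    exact hαK (sub_eq_zero.1 h0 ▸ c.2)
  by_cases hαPW : shift K α P ≤ W
  · exact ⟨0, by simpa using hαPW⟩
  have hle := restrictScalars_sup_span_le (R := R) W e
  have hinf : ∀ (A B : Submodule R F) (C : Submodule K F), C.restrictScalars R ≤ A →
      Module.finrank R A = 2 * Module.finrank K W + 1 →
      Module.finrank K C = Module.finrank K W → B = (shift K α P).restrictScalars R →
      ¬ shift K α P ≤ C → Module.finrank R ↥(A ⊓ B) + 1 ≤ 2 * Module.finrank K W := by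
    rintro A _ C hCA hA hC rfl hnot
    have h1 : Module.finrank K C < Module.finrank K ↥(C ⊔ shift K α P) :=
      Submodule.finrank_lt_finrank_of_lt (left_lt_sup.2 hnot)
    have h2 := finrank_restrictScalars (R := R) (C ⊔ shift K α P)
    have h3 : Module.finrank R ((C ⊔ shift K α P).restrictScalars R) ≤
        Module.finrank R ↥(A ⊔ (shift K α P).restrictScalars R) := by
      rw [restrictScalars_sup]
      exact Submodule.finrank_mono (sup_le_sup_right hCA _)
    have h4 := Submodule.finrank_sup_add_finrank_inf_eq A ((shift K α P).restrictScalars R)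
    have h5 := finrank_restrictScalars (R := R) (shift K α P)
    rw [hK] at h2 h5
    omega
  have hSαS : S ⊓ shift R α S ≤ (shift K α P).restrictScalars R := by
    rw [← hE]
    change _ ≤ T.restrictScalars R ⊓ (shift K α T).restrictScalars R
    rw [restrictScalars_shift]
    exact inf_le_inf hle (shift_mono hle)
  have hr' : Module.finrank R ↥(S ⊓ shift R α S) + 1 = 2 * Module.finrank K W := hr
  have hV1 : S ⊓ shift R α S = S ⊓ (shift K α P).restrictScalars R := by
    refine Submodule.eq_of_le_of_finrank_le (le_inf inf_le_left hSαS) ?_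
    have := hinf S _ W le_sup_left hSdim rfl rfl hαPW
    omega
  have hV2 : S ⊓ shift R α S = shift R α S ⊓ (shift K α P).restrictScalars R := by
    refine Submodule.eq_of_le_of_finrank_le (le_inf inf_le_right hSαS) ?_
    have := hinf (shift R α S) _ (shift K α W)
      (by rw [restrictScalars_shift]; exact shift_mono le_sup_left)
      (by rw [finrank_shift hα, hSdim]) (finrank_shift hα W) rfl (by
        intro h
        have h' : P ≤ W := by
          intro x hx
          exact (mul_mem_shift_iff hα).1 (h (mul_mem_shift hx))
        exact hWP (Submodule.eq_of_le_of_finrank_eq h' hPdim).symm)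
    omega
  obtain ⟨ζ, hζ, hζR⟩ := exists_mem_notMem_range hK
  have hS : ∀ f ∈ P, f ∈ W → α * f ∈ S := by
    intro f hfP hfW
    have : α * f ∈ shift R α S ⊓ (shift K α P).restrictScalars R :=
      ⟨mul_mem_shift (Submodule.mem_sup_left (S := W.restrictScalars R) hfW),
        mul_mem_shift (R := K) hfP⟩
    rw [← hV2] at this
    exact this.1
  have hPW : ∀ f ∈ P, f ∈ W → α * f ∈ W := by
    intro f hfP hfW
    refine mem_of_mem_of_mul_mem he hζ hζR (hS f hfP hfW) ?_
    rw [mul_left_comm]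
    exact hS _ (mul_mem_of_mem_field hζ hfP) (mul_mem_of_mem_field hζ hfW)
  obtain ⟨f₀, hf₀, hf₀W⟩ : ∃ f₀ ∈ P, f₀ ∉ W := by
    by_contra! h
    exact hWP (Submodule.eq_of_le_of_finrank_eq (show P ≤ W from h) hPdim).symm
  have hT : W ⊔ Submodule.span K {f₀} = T := by
    refine Submodule.eq_of_le_of_finrank_eq (sup_le le_sup_left
      ((Submodule.span_singleton_le_iff_mem _ _).2 (hPT hf₀))) ?_
    rw [Submodule.finrank_sup_span_singleton hf₀W, hTW]
  obtain ⟨u, hu, y, hy, h⟩ := Submodule.mem_sup.1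
    (hT.ge (hαPT (mul_mem_shift hf₀) : α * f₀ ∈ T))
  obtain ⟨c, rfl⟩ := Submodule.mem_span_singleton.1 hy
  have hf₀' : (α - algebraMap K F c) * f₀ ∈ W := by
    rw [sub_mul, ← h, Algebra.smul_def, add_sub_cancel_right]
    exact hu
  refine ⟨c, fun x hx => ?_⟩
  obtain ⟨f, hf, rfl⟩ := mem_shift.1 hx
  obtain ⟨v, hv, z, hz, hf'⟩ := Submodule.mem_sup.1 (hT.ge (hPT hf))
  obtain ⟨d, rfl⟩ := Submodule.mem_span_singleton.1 hz
  have hvP : v ∈ P := by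
    rw [eq_sub_of_add_eq hf']
    exact P.sub_mem hf (P.smul_mem d hf₀)
  rw [← hf', mul_add, mul_smul_comm, sub_mul, ← Algebra.smul_def]
  exact W.add_mem (W.sub_mem (hPW v hvP hv) (W.smul_mem c hv)) (W.smul_mem d hf₀')

lemma exists_shift_polySpan_eq (hK : Module.finrank R K = 2) {W : Submodule K F} {e α b : F}
    (he : e ∉ W) (hW : W ≠ ⊥) (hα : α ≠ 0) (hb : b ≠ 0)
    (hT : W ⊔ Submodule.span K {e} =
      shift K b (polySpan K α (Module.finrank K W + 1)))
    (hrT : interDim (W ⊔ Submodule.span K {e}) α = Module.finrank K W)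
    (hr : interDim (W.restrictScalars R ⊔ Submodule.span R {e}) α + 1 =
      2 * Module.finrank K W) :
    ∃ b' β : F, b' ≠ 0 ∧ W = shift K b' (polySpan K β (Module.finrank K W)) ∧
      W ⊔ Submodule.span K {e} = shift K b' (polySpan K β (Module.finrank K W + 1)) := by
  have hTW := Submodule.finrank_sup_span_singleton he
  have hw : 1 ≤ Module.finrank K W := Submodule.one_le_finrank_iff.2 hW
  have hαK : α ∉ K := by
    intro hmem
    have : shift K α (W ⊔ Submodule.span K {e}) = W ⊔ Submodule.span K {e} :=
      shift_eq_of_mem_stabField hα fun v hv => mul_mem_of_mem_field hmem hv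
    rw [interDim, this, inf_idem] at hrT
    omega
  have hdeg := finrank_polySpan_le_finrank_adjoin (R := K) α (Module.finrank K W + 1)
  rw [← finrank_shift hb, ← hT, hTW] at hdeg
  have hPdim : Module.finrank K (shift K b (polySpan K α (Module.finrank K W))) =
      Module.finrank K W := by
    rw [finrank_shift hb, finrank_polySpan (by omega)]
  have hPT : shift K b (polySpan K α (Module.finrank K W)) ≤ W ⊔ Submodule.span K {e} := by
    rw [hT]
    exact shift_mono (polySpan_mono α (Nat.le_succ _))
  have hαP : shift K α (shift K b (polySpan K α (Module.finrank K W))) ≤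
      W ⊔ Submodule.span K {e} := by
    rw [hT, shift_shift, mul_comm, ← shift_shift]
    refine shift_mono fun x hx => ?_
    obtain ⟨y, hy, rfl⟩ := mem_shift.1 hx
    exact mul_mem_polySpan_succ hy
  have hE : (W ⊔ Submodule.span K {e}) ⊓ shift K α (W ⊔ Submodule.span K {e}) =
      shift K α (shift K b (polySpan K α (Module.finrank K W))) := by
    refine (Submodule.eq_of_le_of_finrank_eq (le_inf hαP (shift_mono hPT)) ?_).symm
    rw [finrank_shift hα, hPdim]
    exact hrT.symm
  rcases eq_or_exists_shift_sub_eq hK he hα hαK hPT hPdim hE hr with h | ⟨c, h⟩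
  · exact ⟨b, α, hb, h, hT⟩
  · have hγ : α - algebraMap K F c ≠ 0 := fun h0 => hαK (sub_eq_zero.1 h0 ▸ c.2)
    obtain ⟨m, hm⟩ := Nat.exists_eq_add_of_le' hw
    refine ⟨b * (α - algebraMap K F c) ^ Module.finrank K W, (α - algebraMap K F c)⁻¹,
      mul_ne_zero hb (pow_ne_zero _ hγ), ?_, ?_⟩
    · refine h.trans ?_
      rw [← polySpan_sub_algebraMap α c, hm, ← shift_pow_polySpan_inv hγ, shift_shift,
        shift_shift]
      congr 1
      ring
    · rw [hT, ← polySpan_sub_algebraMap α c, ← shift_pow_polySpan_inv hγ, shift_shift]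

lemma exists_eq_shift_polySpan_sup_span {W : Submodule K F} {e β b : F}
    (he : e ∉ W) (hb : b ≠ 0) {m : ℕ} (hW : W = shift K b (polySpan K β m))
    (hT : W ⊔ Submodule.span K {e} = shift K b (polySpan K β (m + 1))) :
    ∃ a : F, a ≠ 0 ∧ W.restrictScalars R ⊔ Submodule.span R {e} =
      shift R a ((polySpan K β m).restrictScalars R ⊔ Submodule.span R {β ^ m}) := by
  rw [polySpan_succ, shift_sup, ← hW, shift_span_singleton] at hT
  obtain ⟨u, hu, y, hy, h⟩ := Submodule.mem_sup.1
    (hT.le (Submodule.mem_sup_right (Submodule.mem_span_singleton_self e)))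
  obtain ⟨κ, rfl⟩ := Submodule.mem_span_singleton.1 hy
  have hκ : (κ : F) ≠ 0 := by
    intro h0
    have : κ = 0 := Subtype.ext h0
    rw [this, zero_smul, add_zero] at h
    exact he (h ▸ hu)
  refine ⟨κ * b, mul_ne_zero hκ hb, ?_⟩
  have hκW : shift K (κ : F) W = W :=
    shift_eq_of_mem_stabField hκ fun v hv => mul_mem_of_mem_field κ.2 hv
  rw [shift_sup, ← restrictScalars_shift, ← shift_shift, ← hW, hκW, shift_span_singleton]
  have hκe : κ * b * β ^ m = e - u := by
    rw [← h, Algebra.smul_def, add_sub_cancel_left, mul_assoc]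
    rfl
  have hu' : u ∈ W.restrictScalars R := hu
  refine le_antisymm (sup_le le_sup_left ?_) (sup_le le_sup_left ?_)
  · rw [Submodule.span_singleton_le_iff_mem, ← sub_add_cancel e u, ← hκe]
    exact Submodule.add_mem _ (Submodule.mem_sup_right (Submodule.mem_span_singleton_self _))
      (Submodule.mem_sup_left hu')
  · rw [Submodule.span_singleton_le_iff_mem, hκe]
    exact Submodule.sub_mem _ (Submodule.mem_sup_right (Submodule.mem_span_singleton_self _))
      (Submodule.mem_sup_left hu')

lemma two_mul_lt_finrank_adjoin (hK : Module.finrank R K = 2) {β : F} {m : ℕ} (hm : 1 ≤ m)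
    (hdeg : m + 1 ≤ Module.finrank K (IntermediateField.adjoin K {β}))
    (hS : AllInterDims ((polySpan K β m).restrictScalars R ⊔ Submodule.span R {β ^ m})) :
    2 * m < Module.finrank K (IntermediateField.adjoin K {β}) := by
  by_contra! hlt
  obtain ⟨α, hα, hr⟩ := hS 1 le_rfl (by rw [finrank_polySpan_sup_span hK hdeg]; omega)
  have hβm : β ^ m ∉ polySpan K β m := by
    intro h
    have h' : polySpan K β (m + 1) = polySpan K β m := by
      rw [polySpan_succ, sup_eq_left, Submodule.span_singleton_le_iff_mem]
      exact h
    have := finrank_polySpan hdeg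
    rw [h', finrank_polySpan (by omega)] at this
    omega
  have hb := interDim_sup_span_bounds (R := R) hK hβm hα
  rw [hr, ← polySpan_succ] at hb
  have hle := polySpan_le_field (R := K) (m + 1) (IntermediateField.mem_adjoin_simple_self K β)
  by_cases hmem : α ∈ IntermediateField.adjoin K {β}
  · have := two_mul_finrank_le_of_le_field hle hmem hα
    rw [finrank_polySpan hdeg] at this
    omega
  · have := interDim_eq_zero_of_le_field hle hmem
    omega

end Quadratic

section Classification

variable {R F : Type*} [Field R] [Field F] [Algebra R F]

lemma mem_orb_of_eq_shift {S S' : Submodule R F} {a : F} (ha : a ≠ 0) (h : S = shift R a S') :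
    S' ∈ orb R S :=
  ⟨a⁻¹, inv_ne_zero ha, by rw [h, shift_inv_shift ha]⟩

variable [Finite F]

lemma isFWS_of_mem_orb {S S' : Submodule R F} (h : S' ∈ orb R S) : IsFWS R S' ↔ IsFWS R S := by
  obtain ⟨α, hα, rfl⟩ := h
  exact isFWS_shift_iff hα

lemma notMem_range_of_interDim_ne {S : Submodule R F} {α : F} (hα : α ≠ 0)
    (h : interDim S α ≠ Module.finrank R S) : α ∉ Set.range (algebraMap R F) := by
  rintro ⟨c, rfl⟩
  have : Module.Finite R F := Module.Finite.of_finite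
  apply h
  rw [interDim, shift_eq_of_mem_stabField hα ((stabField S).algebraMap_mem c), inf_idem]

/-- The degree bound for a full weight spectrum code generated by powers of `α`. -/
lemma IsFWS.finrank_bound {S : Submodule R F} (hS : IsFWS R S) {α b : F} {k : ℕ} (hb : b ≠ 0)
    (h : S = shift R b (polySpan R α k)) (hk : Module.finrank R S = k) (hk2 : 2 ≤ k) :
    (Module.finrank R (IntermediateField.adjoin R {α}) < Module.finrank R F ∧
      2 * k ≤ Module.finrank R (IntermediateField.adjoin R {α}) + 1) ∨
    (Module.finrank R (IntermediateField.adjoin R {α}) = Module.finrank R F ∧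
      2 * k ≤ Module.finrank R F) := by
  have : Module.Finite R F := Module.Finite.of_finite
  have hP : IsFWS R (polySpan R α k) :=
    (isFWS_of_mem_orb (mem_orb_of_eq_shift hb h)).2 hS
  have hPk : Module.finrank R (polySpan R α k) = k := by
    rw [← finrank_shift hb, ← h, hk]
  rw [isFWS_iff, hPk] at hP
  have hle : Module.finrank R (IntermediateField.adjoin R {α}) ≤ Module.finrank R F :=
    Submodule.finrank_le (IntermediateField.adjoin R {α}).toSubalgebra.toSubmodule
  rcases hle.lt_or_eq with hlt | heq
  · obtain ⟨γ, hγ, hr⟩ := hP 1 (by omega)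
    have hPle := polySpan_le_field k (IntermediateField.mem_adjoin_simple_self R α)
    by_cases hmem : γ ∈ IntermediateField.adjoin R {α}
    · have := two_mul_finrank_le_of_le_field hPle hmem hγ
      exact Or.inl ⟨hlt, by omega⟩
    · rw [interDim_eq_zero_of_le_field hPle hmem] at hr
      omega
  · obtain ⟨γ, hγ, hr⟩ := hP 0 (by omega)
    have h1 := interDim_add_finrank_sup hγ (polySpan R α k)
    have h2 := Submodule.finrank_le (polySpan R α k ⊔ shift R γ (polySpan R α k))
    exact Or.inr ⟨heq, by omega⟩

lemma IsFWS.exists_polySpan_of_finrank_eq_one {S : Submodule R F} (hS : IsFWS R S)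
    (h1 : Module.finrank R S = 1) : ∃ l : F, l ∉ Set.range (algebraMap R F) ∧
      polySpan R l 1 ∈ orb R S ∧ 2 ≤ Module.finrank R F := by
  have : Module.Finite R F := Module.Finite.of_finite
  obtain ⟨α, hα, hr⟩ := isFWS_iff.1 hS 0 (by omega)
  have h2 := interDim_add_finrank_sup hα S
  have h3 := Submodule.finrank_le (S ⊔ shift R α S)
  refine ⟨α, notMem_range_of_interDim_ne (S := S) hα (by omega), ?_, by omega⟩
  obtain ⟨⟨s, hs⟩, hs0, -⟩ := finrank_eq_one_iff'.1 h1
  have hs0 : s ≠ 0 := fun h => hs0 (Subtype.ext h)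
  refine mem_orb_of_eq_shift hs0 ?_
  rw [polySpan_succ, polySpan_zero, bot_sup_eq, pow_zero, shift_span_singleton, mul_one]
  symm
  refine Submodule.eq_of_le_of_finrank_eq ((Submodule.span_singleton_le_iff_mem _ _).2 hs) ?_
  rw [finrank_span_singleton hs0, h1]

lemma IsFWS.exists_polySpan_sup_span {W S : Submodule R F} (hS : IsFWS R S)
    [FiniteDimensional R F] (hW : W ≠ ⊥)
    (hWS : W ≤ S) (hK : Module.finrank R (stabField W) = 2)
    (hdim : Module.finrank R S = Module.finrank R W + 1) :
    ∃ m, 1 ≤ m ∧ Module.finrank R S = 2 * m + 1 ∧ ∃ l ∉ stabField W,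
      (polySpan (stabField W) l m).restrictScalars R ⊔ Submodule.span R {l ^ m} ∈ orb R S ∧
      2 * m < Module.finrank (stabField W) (IntermediateField.adjoin (stabField W) {l}) := by
  set K := stabField W with hKdef
  obtain ⟨V, hV⟩ : ∃ V : Submodule K F, V.restrictScalars R = W :=
    ⟨extendScalars W le_rfl, rfl⟩
  have hWV : Module.finrank R W = 2 * Module.finrank K V := by
    rw [← hV, finrank_restrictScalars, hK]
  have hV0 : V ≠ ⊥ := by
    rintro rfl
    exact hW hV.symm
  have hv : 1 ≤ Module.finrank K V := Submodule.one_le_finrank_iff.2 hV0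
  have hWneS : W ≠ S := by
    rintro rfl
    omega
  obtain ⟨e, heS, heW⟩ := SetLike.exists_of_lt (lt_of_le_of_ne hWS hWneS)
  have he : e ∉ V := by
    rw [← hV] at heW
    exact heW
  have hSe : V.restrictScalars R ⊔ Submodule.span R {e} = S := by
    refine Submodule.eq_of_le_of_finrank_eq
      (sup_le (hV.trans_le hWS) ((Submodule.span_singleton_le_iff_mem _ _).2 heS)) ?_
    rw [finrank_restrictScalars_sup_span hK he]
    omega
  have hSk : Module.finrank R S = 2 * Module.finrank K V + 1 := by omega
  have hT := Submodule.finrank_sup_span_singleton he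
  have hSA : AllInterDims (V.restrictScalars R ⊔ Submodule.span R {e}) := hSe.symm ▸ hS.allInterDims
  obtain ⟨α, hα, hr⟩ := hSA (2 * Module.finrank K V - 1) (by omega) (by rw [hSe]; omega)
  have hb := interDim_sup_span_bounds (R := R) hK he hα
  have hrT : interDim (V ⊔ Submodule.span K {e}) α = Module.finrank K V := by omega
  rcases eq_shift_polySpan_or_exists_stabField (allInterDims_sup_span hK he hSA) hα (by omega)
    with ⟨b, hb0, h⟩ | ⟨W', -, hle, -, hfr, hst⟩
  · rw [hT] at h
    obtain ⟨b', l, hb', hVb, hTb⟩ := exists_shift_polySpan_eq hK he hV0 hα hb0 h hrT (by omega)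
    obtain ⟨a, ha, hSa⟩ := exists_eq_shift_polySpan_sup_span (R := R) he hb' hVb hTb
    rw [hSe] at hSa
    have hmem := mem_orb_of_eq_shift ha hSa
    have hdeg := finrank_polySpan_le_finrank_adjoin (R := K) l (Module.finrank K V + 1)
    rw [← finrank_shift hb', ← hTb, hT] at hdeg
    refine ⟨Module.finrank K V, hv, hSk, l, ?_, hmem, two_mul_lt_finrank_adjoin hK hv hdeg
      ((isFWS_of_mem_orb hmem).2 hS).allInterDims⟩
    intro hl
    have : Module.finrank K (IntermediateField.adjoin K {l}) = 1 :=
      IntermediateField.finrank_adjoin_simple_eq_one_iff.2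
        (IntermediateField.mem_bot.2 ⟨⟨l, hl⟩, rfl⟩)
    omega
  · exact (not_forall_interDim_or_mem_stabField hK he hV0 hSA hle hfr hst).elim

end Classification

end FWS

/-- Theorem 1.1, main theorem: classification of full weight spectrum
one-orbit cyclic subspace codes. -/
theorem fws_classification
    {Fq F : Type*} [Field Fq] [Field F] [Algebra Fq F] [Fintype Fq] [Fintype F]
    (q n k : ℕ) (hq : Fintype.card Fq = q) (hn : Module.finrank Fq F = n)
    (S : Submodule Fq F) (hSk : Module.finrank Fq ↥S = k) (hk : 1 ≤ k) :
    IsFWS Fq S ↔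
      ∃ S' ∈ orb Fq S,
        -- Family (1): `S' = ⟨1, λ, ..., λ^(k-1)⟩_{F_q}`
        (∃ lam : F, lam ∉ Set.range (algebraMap Fq F) ∧
          S' = polySpan Fq lam k ∧
          ((Module.finrank Fq ↥(IntermediateField.adjoin Fq {lam}) < n ∧
              2 * k ≤ Module.finrank Fq ↥(IntermediateField.adjoin Fq {lam}) + 1) ∨
           (Module.finrank Fq ↥(IntermediateField.adjoin Fq {lam}) = n ∧ 2 * k ≤ n))) ∨
        -- Family (2): `S' = ⟨1, λ, ..., λ^(l-1)⟩_{F_{q^2}} ⊕ λ^l F_q`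
        (∃ l : ℕ, 1 ≤ l ∧ k = 2 * l + 1 ∧ Even n ∧
          ∃ T2 : IntermediateField Fq F, Module.finrank Fq ↥T2 = 2 ∧
            ∃ lam : F, lam ∉ T2 ∧
              S' = (polySpan ↥T2 lam l).restrictScalars Fq ⊔ Submodule.span Fq {lam ^ l} ∧
              2 * l < Module.finrank ↥T2 ↥(IntermediateField.adjoin ↥T2 {lam})) := by
  have : Module.Finite Fq F := Module.Finite.of_finite
  subst hq hn hSk
  constructor
  · intro hS
    rcases hk.eq_or_lt' with h1 | hk2
    · obtain ⟨l, hl, hmem, h2⟩ := hS.exists_polySpan_of_finrank_eq_one h1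
      refine ⟨_, hmem, Or.inl ⟨l, hl, by rw [h1], ?_⟩⟩
      have hle : Module.finrank Fq (IntermediateField.adjoin Fq {l}) ≤ Module.finrank Fq F :=
        Submodule.finrank_le (IntermediateField.adjoin Fq {l}).toSubalgebra.toSubmodule
      have hpos : 0 < Module.finrank Fq (IntermediateField.adjoin Fq {l}) := Module.finrank_pos
      omega
    · obtain ⟨α, hα, hr⟩ := isFWS_iff.1 hS (Module.finrank Fq S - 1) (by omega)
      rcases eq_shift_polySpan_or_exists_stabField hS.allInterDims hα (by omega)
        with ⟨b, hb, h⟩ | ⟨W, hW, hWS, hK, hdim, -⟩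
      · exact ⟨_, mem_orb_of_eq_shift hb h, Or.inl ⟨α,
          notMem_range_of_interDim_ne (S := S) hα (by omega), rfl,
          hS.finrank_bound hb h rfl hk2⟩⟩
      · obtain ⟨m, hm, hSm, l, hl, hmem, hdeg⟩ := hS.exists_polySpan_sup_span hW hWS hK hdim
        refine ⟨_, hmem, Or.inr ⟨m, hm, hSm, ?_, stabField W, hK, l, hl, rfl, hdeg⟩⟩
        rw [← Module.finrank_mul_finrank Fq (stabField W) F, hK]
        exact even_two_mul _
  · rintro ⟨S', hS', ⟨l, hl, rfl, h⟩ | ⟨m, -, -, -, K, hK, l, hl, rfl, h⟩⟩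
    · exact (isFWS_of_mem_orb hS').1 (isFWS_polySpan hl h)
    · exact (isFWS_of_mem_orb hS').1 (isFWS_polySpan_sup_span hK hl h)
end

section
/- Let C₁ = Orb(S₁) and C₂ = Orb(S₂) be one-orbit cyclic subspace codes in G_q(n,k). If there exists an F_q-linear bijection ψ : F_{q^n} → F_{q^n} such that {ψ(V) : V ∈ C₁} = C₂, then m(C₁) = m(C₂). -/
/-!
Setting: `q` is a prime power, realized by a finite field `Fq` with `Fintype.card Fq = q`;
`F` plays the role of `F_{q^n}`: a finite field extension of `Fq` with `Module.finrank Fq F = n`.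
`F_q`-subspaces of `F_{q^n}` are `Submodule Fq F`; for a divisor `t` of `n`, the subfield
`F_{q^t}` is the (unique) `T : IntermediateField Fq F` with `Module.finrank Fq ↥T = t`, and
`F_{q^t}`-subspaces are `Submodule ↥T F`.
-/

set_option synthInstance.maxHeartbeats 1000000

namespace FWS

variable {R F : Type*} [Field R] [Field F] [Algebra R F]

/-- A subspace `W` is saturated for a family `C` of subspaces if it contains every member of `C`
that it meets nontrivially. -/
def IsSaturated (C : Set (Submodule R F)) (W : Submodule R F) : Prop :=
  ∀ V ∈ C, ∀ x ∈ V, x ∈ W → x ≠ 0 → V ≤ W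

/-- The least dimension of a nonzero subspace saturated for `C`. -/
noncomputable def minSaturatedDim (C : Set (Submodule R F)) : ℕ :=
  sInf {d | ∃ W : Submodule R F, W ≠ ⊥ ∧ IsSaturated C W ∧ Module.finrank R ↥W = d}

theorem IsSaturated.map {C : Set (Submodule R F)} {W : Submodule R F} (hW : IsSaturated C W)
    (ψ : F ≃ₗ[R] F) :
    IsSaturated ((fun V : Submodule R F => V.map (ψ : F →ₗ[R] F)) '' C)
      (W.map (ψ : F →ₗ[R] F)) := by
  rintro _ ⟨V, hV, rfl⟩ _ ⟨x, hxV, rfl⟩ ⟨y, hyW, hyx⟩ hx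
  obtain rfl : y = x := ψ.injective hyx
  exact Submodule.map_mono (hW V hV y hxV hyW fun h => hx (by simp [h]))

theorem minSaturatedDim_image (C : Set (Submodule R F)) (ψ : F ≃ₗ[R] F) :
    minSaturatedDim ((fun V : Submodule R F => V.map (ψ : F →ₗ[R] F)) '' C) =
      minSaturatedDim C := by
  unfold minSaturatedDim
  congr 1
  ext d
  constructor
  · rintro ⟨W, hW, hsat, rfl⟩
    refine ⟨W.map (ψ.symm : F →ₗ[R] F), by simpa using hW, ?_, ψ.symm.finrank_map_eq W⟩
    have h := hsat.map ψ.symm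
    rwa [Set.image_image, Set.image_congr (g := id), Set.image_id] at h
    intro V _
    ext x
    simp
  · rintro ⟨W, hW, hsat, rfl⟩
    exact ⟨W.map (ψ : F →ₗ[R] F), by simpa using hW, hsat.map ψ, ψ.finrank_map_eq W⟩

theorem IsSaturated.div_mul_mem {S W : Submodule R F} (hW : IsSaturated (orb R S) W) {s s' w : F}
    (hs : s ∈ S) (hs' : s' ∈ S) (hs0 : s ≠ 0) (hw : w ∈ W) : s' / s * w ∈ W := by
  rcases eq_or_ne w 0 with rfl | hw0
  · simp
  refine hW (shift R (w / s) S) ⟨w / s, div_ne_zero hw0 hs0, rfl⟩ w ⟨s, hs, ?_⟩ hw hw0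
    ⟨s', hs', ?_⟩
  · simp [hs0]
  · simp only [LinearMap.mulLeft_apply]
    ring

theorem finrank_span_eq_one_iff {S : Submodule R F} (hS : S ≠ ⊥) (T : IntermediateField R F) :
    Module.finrank ↥T ↥(Submodule.span ↥T (S : Set F)) = 1 ↔
      ∀ s ∈ S, ∀ s' ∈ S, s ≠ 0 → s' / s ∈ T := by
  constructor
  · intro h s hs s' hs' hs0
    obtain ⟨v, -, hv⟩ := finrank_eq_one_iff'.1 h
    obtain ⟨c, hc⟩ := hv ⟨s, Submodule.subset_span hs⟩
    obtain ⟨c', hc'⟩ := hv ⟨s', Submodule.subset_span hs'⟩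
    replace hc : (c : F) * v = s := congrArg Subtype.val hc
    replace hc' : (c' : F) * v = s' := congrArg Subtype.val hc'
    rw [← hc, ← hc', mul_div_mul_right _ _ (right_ne_zero_of_mul (hc ▸ hs0))]
    exact T.div_mem c'.2 c.2
  · intro h
    obtain ⟨s, hs, hs0⟩ := S.ne_bot_iff.1 hS
    have hspan : Submodule.span ↥T (S : Set F) = Submodule.span ↥T {s} := by
      refine le_antisymm (Submodule.span_le.2 fun s' hs' => ?_)
        (Submodule.span_mono (Set.singleton_subset_iff.2 hs))
      exact Submodule.mem_span_singleton.2 ⟨⟨s' / s, h s hs s' hs' hs0⟩, div_mul_cancel₀ s' hs0⟩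
    rw [hspan, finrank_span_singleton hs0]

theorem isSaturated_of_div_mem {S : Submodule R F} (T : IntermediateField R F)
    (h : ∀ s ∈ S, ∀ s' ∈ S, s ≠ 0 → s' / s ∈ T) :
    IsSaturated (orb R S) (Subalgebra.toSubmodule T.toSubalgebra) := by
  rintro _ ⟨α, -, rfl⟩ _ ⟨s, hs, rfl⟩ hT hs0 _ ⟨s', hs', rfl⟩
  simp only [LinearMap.mulLeft_apply, Subalgebra.mem_toSubmodule,
    IntermediateField.mem_toSubalgebra] at hT hs0 ⊢
  have hs0' := right_ne_zero_of_mul hs0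
  have : α * s' = α * s * (s' / s) := by field_simp
  rw [this]
  exact T.mul_mem hT (h s hs s' hs' hs0')

theorem mul_mem_of_mem_adjoin [FiniteDimensional R F] {A : Set F} {W : Submodule R F}
    (h : ∀ a ∈ A, ∀ w ∈ W, a * w ∈ W) {x : F} (hx : x ∈ IntermediateField.adjoin R A) :
    ∀ w ∈ W, x * w ∈ W := by
  rw [← IntermediateField.mem_toSubalgebra,
    IntermediateField.adjoin_toSubalgebra_of_isAlgebraic
      (fun x _ => Algebra.IsAlgebraic.isAlgebraic x)] at hx
  induction hx using Algebra.adjoin_induction with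
  | mem a ha => exact h a ha
  | algebraMap r => exact fun w hw => by simpa [Algebra.smul_def] using W.smul_mem r hw
  | add x y _ _ hx hy => exact fun w hw => by simpa [add_mul] using W.add_mem (hx w hw) (hy w hw)
  | mul x y _ _ hx hy => exact fun w hw => by simpa [mul_assoc] using hx _ (hy w hw)

theorem mOrb_eq_minSaturatedDim [FiniteDimensional R F] {S : Submodule R F} (hS : S ≠ ⊥) :
    mOrb R S = minSaturatedDim (orb R S) := by
  let A : Set F := {x | ∃ s ∈ S, ∃ s' ∈ S, s ≠ 0 ∧ s' / s = x}
  let T := IntermediateField.adjoin R A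
  have hT : ∀ s ∈ S, ∀ s' ∈ S, s ≠ 0 → s' / s ∈ T := fun s hs s' hs' hs0 =>
    IntermediateField.subset_adjoin R A ⟨s, hs, s', hs', hs0, rfl⟩
  have toSat : ∀ K : IntermediateField R F, (∀ s ∈ S, ∀ s' ∈ S, s ≠ 0 → s' / s ∈ K) →
      Module.finrank R ↥K ∈
        {d | ∃ W : Submodule R F, W ≠ ⊥ ∧ IsSaturated (orb R S) W ∧ Module.finrank R ↥W = d} :=
    fun K hK => ⟨Subalgebra.toSubmodule K.toSubalgebra,
      (Submodule.ne_bot_iff _).2 ⟨1, K.one_mem, one_ne_zero⟩, isSaturated_of_div_mem K hK, rfl⟩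
  have hmem : Module.finrank R ↥T ∈ {t : ℕ | t ∣ Module.finrank R F ∧
      ∃ K : IntermediateField R F, Module.finrank R ↥K = t ∧
        Module.finrank ↥K ↥(Submodule.span ↥K (S : Set F)) = 1} :=
    ⟨⟨_, (Module.finrank_mul_finrank R ↥T F).symm⟩, T, rfl, (finrank_span_eq_one_iff hS T).2 hT⟩
  apply le_antisymm
  · refine (Nat.sInf_le hmem).trans (le_csInf ⟨_, toSat T hT⟩ ?_)
    rintro _ ⟨W, hW, hsat, rfl⟩
    obtain ⟨w, hw, hw0⟩ := W.ne_bot_iff.1 hW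
    have hA : ∀ a ∈ A, ∀ w ∈ W, a * w ∈ W := by
      rintro _ ⟨s, hs, s', hs', hs0, rfl⟩ w hw
      exact hsat.div_mul_mem hs hs' hs0 hw
    let f : ↥T →ₗ[R] ↥W := LinearMap.codRestrict W
      ((LinearMap.mulRight R w).comp T.val.toLinearMap)
      fun x => mul_mem_of_mem_adjoin hA x.2 w hw
    refine LinearMap.finrank_le_finrank_of_injective (f := f) fun x y hxy => ?_
    exact Subtype.ext (mul_right_cancel₀ hw0 (congrArg Subtype.val hxy))
  · refine le_csInf ⟨_, hmem⟩ ?_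
    rintro _ ⟨-, K, rfl, hK⟩
    exact Nat.sInf_le (toSat K ((finrank_span_eq_one_iff hS K).1 hK))

end FWS

open FWS

/-- if two one-orbit cyclic subspace codes are linearly isometric, then
they have the same invariant `m`. -/
theorem mOrb_eq_of_linearly_isometric
    {Fq F : Type*} [Field Fq] [Field F] [Algebra Fq F] [Fintype Fq] [Fintype F]
    (q n k : ℕ) (hq : Fintype.card Fq = q) (hn : Module.finrank Fq F = n)
    (S₁ S₂ : Submodule Fq F)
    (hS₁ : Module.finrank Fq ↥S₁ = k) (hS₂ : Module.finrank Fq ↥S₂ = k)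
    (ψ : F ≃ₗ[Fq] F)
    (hψ : (fun V : Submodule Fq F => V.map (ψ : F →ₗ[Fq] F)) '' orb Fq S₁ = orb Fq S₂) :
    mOrb Fq S₁ = mOrb Fq S₂ := by
  rcases eq_or_ne S₁ ⊥ with rfl | h₁
  · obtain rfl : S₂ = ⊥ := Submodule.finrank_eq_zero.1 (by rw [hS₂, ← hS₁, finrank_bot])
    rfl
  · have h₂ : S₂ ≠ ⊥ := by
      rintro rfl
      exact h₁ (Submodule.finrank_eq_zero.1 (by rw [hS₁, ← hS₂, finrank_bot]))
    rw [mOrb_eq_minSaturatedDim h₁, mOrb_eq_minSaturatedDim h₂, ← hψ, minSaturatedDim_image]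
end

section
/- Let S ∈ G_q(n,k) and C = Orb(S). If ω_{2i}(C) > 0 for some i ∈ {1,…,k}, then k ≡ i (mod [H(S):F_q]). -/
/-!
Setting: `q` is a prime power, realized by a finite field `Fq` with `Fintype.card Fq = q`;
`F` plays the role of `F_{q^n}`: a finite field extension of `Fq` with `Module.finrank Fq F = n`.
`F_q`-subspaces of `F_{q^n}` are `Submodule Fq F`; for a divisor `t` of `n`, the subfield
`F_{q^t}` is the (unique) `T : IntermediateField Fq F` with `Module.finrank Fq ↥T = t`, and
`F_{q^t}`-subspaces are `Submodule ↥T F`.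
-/

set_option synthInstance.maxHeartbeats 1000000

open FWS

/-- The multiplier ring `{x : x S ⊆ S}` of a subspace of a finite field, as an intermediate field. -/
def multiplierField {K F : Type*} [Field K] [Field F] [Algebra K F] [Finite F]
    (S : Submodule K F) : IntermediateField K F :=
  let A : Subalgebra K F :=
    { carrier := {x | ∀ s ∈ S, x * s ∈ S}
      mul_mem' := fun {a b} ha hb s hs => by
        rw [mul_assoc]
        exact ha _ (hb s hs)
      add_mem' := fun {a b} ha hb s hs => by
        rw [add_mul]
        exact S.add_mem (ha s hs) (hb s hs)
      algebraMap_mem' := fun r s hs => by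
        rw [← Algebra.smul_def]
        exact S.smul_mem r hs }
  A.toIntermediateField fun x hx =>
    have : Module.Finite K F := Module.Finite.of_finite
    A.inv_mem_of_algebraic (x := ⟨x, hx⟩) (Algebra.IsAlgebraic.isAlgebraic (R := K) x)

theorem mem_multiplierField {K F : Type*} [Field K] [Field F] [Algebra K F] [Finite F]
    {S : Submodule K F} {x : F} : x ∈ multiplierField S ↔ ∀ s ∈ S, x * s ∈ S :=
  Iff.rfl

theorem coe_multiplierField {K F : Type*} [Field K] [Field F] [Algebra K F] [Finite F]
    (S : Submodule K F) : (multiplierField S : Set F) = stab (S : Set F) := by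
  ext x
  rw [SetLike.mem_coe, mem_multiplierField]
  constructor
  · intro hx
    by_cases h0 : x = 0
    · exact Or.inr h0
    · refine Or.inl ⟨h0, Set.eq_of_subset_of_ncard_le ?_ ?_ (Set.toFinite _)⟩
      · rintro _ ⟨s, hs, rfl⟩
        exact hx s hs
      · rw [Set.ncard_image_of_injective _ (mul_right_injective₀ h0)]
  · rintro (⟨-, hx⟩ | rfl) s hs
    · have : x * s ∈ (fun y => x * y) '' (S : Set F) := ⟨s, hs, rfl⟩
      rwa [hx] at this
    · simp

theorem finrank_dvd_finrank_of_mul_mem {K F : Type*} [Field K] [Field F] [Algebra K F]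
    (L : IntermediateField K F) (W : Submodule K F)
    (hW : ∀ x ∈ L, ∀ w ∈ W, x * w ∈ W) :
    Module.finrank K L ∣ Module.finrank K W := by
  let W' : Submodule L F :=
    { W.toAddSubmonoid with smul_mem' := fun x w hw => hW x x.2 w hw }
  exact ⟨Module.finrank L W', (Module.finrank_mul_finrank K L W').symm⟩

theorem finrank_shift {K F : Type*} [Field K] [Field F] [Algebra K F] (S : Submodule K F)
    {α : F} (hα : α ≠ 0) : Module.finrank K (shift K α S) = Module.finrank K S :=
  (S.equivMapOfInjective (LinearMap.mulLeft K α) (mul_right_injective₀ hα)).finrank_eq.symm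

/-- Lemma 3.1: if `ω_{2i}(Orb(S)) > 0` for some `i ∈ {1,…,k}`, then
`k ≡ i (mod [H(S):F_q])`, where `[H(S):F_q] = d` is characterized by `#H(S) = q^d`. -/
theorem weight_congruence_mod_stabilizer_degree
    {Fq F : Type*} [Field Fq] [Field F] [Algebra Fq F] [Fintype Fq] [Fintype F]
    (q n k : ℕ) (hq : Fintype.card Fq = q) (hn : Module.finrank Fq F = n)
    (S : Submodule Fq F) (hSk : Module.finrank Fq ↥S = k)
    (i : ℕ) (hi1 : 1 ≤ i) (hik : i ≤ k) (hω : 0 < omega Fq S i)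
    (d : ℕ) (hd : Nat.card ↥(stab (S : Set F)) = q ^ d) :
    k ≡ i [MOD d] := by
  have hcard : Nat.card (multiplierField S) = q ^ d :=
    (Nat.card_congr (Equiv.setCongr (coe_multiplierField S))).trans hd
  have hd' : Module.finrank Fq (multiplierField S) = d := by
    rw [Module.natCard_eq_pow_finrank (K := Fq), Nat.card_eq_fintype_card, hq] at hcard
    exact Nat.pow_right_injective (hq ▸ Fintype.one_lt_card) hcard
  obtain ⟨⟨⟨T, ⟨α, hα, rfl⟩, hT⟩⟩, -⟩ := Nat.card_pos_iff.mp hω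
  have hdvd : d ∣ Module.finrank Fq ↥(S ⊓ shift Fq α S) := by
    rw [← hd']
    refine finrank_dvd_finrank_of_mul_mem _ _ ?_
    rintro x hx w ⟨hw, s, hs, rfl⟩
    exact ⟨hx _ hw, x * s, hx s hs, mul_left_comm α x s⟩
  have hk : k = i + Module.finrank Fq ↥(S ⊓ shift Fq α S) := by
    rw [sdist, finrank_shift S hα, hSk] at hT
    omega
  rw [hk]
  exact ((Nat.modEq_iff_dvd' (Nat.le_add_right i _)).mpr (by simpa using hdvd)).symm
end
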